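/- arXiv:2003.01361 — 2 statements merged into one kernel-verified Lean document; each statement's English description precedes it below -/
import Mathlib

section
/- Let T : [0,1] → [0,1] be a mixing piecewise C² expanding map (with expansion constant λ > 1) satisfying the large image property, with an ergodic invariant absolutely continuous probability measure μ whose density h is of bounded variation and satisfies c⁻¹ ≤ h ≤ c for some c ≥ 1. Let (r_n) be a sequence of nonnegative reals such that n^{−γ} = O(r_n) for some γ > 0. Then there exists a constant C > 0 such that for all m, n ∈ ℕ, μ(E_n ∩ E_{n+m}) ≤ C μ(E_{n+m}) (μ(E_n) + λ^{−m}). -/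
open MeasureTheory

/-- `T` is a piecewise `C²` expanding map of `[0,1]` with expansion constants
`1 < lam ≤ Lam`. -/
def IsPiecewiseC2ExpandingWith (T : ℝ → ℝ) (lam Lam : ℝ) : Prop :=
  1 < lam ∧ lam ≤ Lam ∧ Set.MapsTo T (Set.Icc 0 1) (Set.Icc 0 1) ∧
  ∃ (N : ℕ) (a : ℕ → ℝ), 0 < N ∧ a 0 = 0 ∧ a N = 1 ∧ (∀ i < N, a i < a (i + 1)) ∧
    ∀ i < N, ∃ g : ℝ → ℝ,
      ContDiffOn ℝ 2 g (Set.Icc (a i) (a (i + 1))) ∧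
      Set.EqOn T g (Set.Ico (a i) (a (i + 1))) ∧
      ∀ x ∈ Set.Icc (a i) (a (i + 1)),
        lam ≤ |derivWithin g (Set.Icc (a i) (a (i + 1))) x| ∧
        |derivWithin g (Set.Icc (a i) (a (i + 1))) x| ≤ Lam

/-- `T` is a piecewise `C²` expanding map of `[0,1]`. -/
def IsPiecewiseC2Expanding (T : ℝ → ℝ) : Prop :=
  ∃ lam Lam : ℝ, IsPiecewiseC2ExpandingWith T lam Lam

/-- The system `(T, μ)` is mixing. -/
def Mixing (T : ℝ → ℝ) (μ : Measure ℝ) : Prop :=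
  ∀ A B : Set ℝ, MeasurableSet A → MeasurableSet B →
    Filter.Tendsto (fun n => μ (A ∩ T^[n] ⁻¹' B)) Filter.atTop (nhds (μ A * μ B))

/-- The set `E_n = {x ∈ [0,1] : |T^n(x) − x| < r_n}`. -/
def En (T : ℝ → ℝ) (r : ℕ → ℝ) (n : ℕ) : Set ℝ :=
  {x ∈ Set.Icc (0:ℝ) 1 | |T^[n] x - x| < r n}

/-- `I` is a maximal interval of continuity of `T^n` in `[0,1]`. -/
def MaximalIntervalOfContinuity (T : ℝ → ℝ) (n : ℕ) (I : Set ℝ) : Prop :=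
  I.Nonempty ∧ I ⊆ Set.Icc 0 1 ∧ I.OrdConnected ∧ ContinuousOn (T^[n]) I ∧
  ∀ J : Set ℝ, J ⊆ Set.Icc 0 1 → J.OrdConnected → ContinuousOn (T^[n]) J → I ⊆ J → J = I

/-- The large image property: there is `c₀ ∈ (0,1]` such that for every `n`, the image
under `T^n` of every maximal interval of continuity of `T^n` has length at least `c₀`. -/
def LargeImageProperty (T : ℝ → ℝ) : Prop :=
  ∃ c₀ : ℝ, 0 < c₀ ∧ c₀ ≤ 1 ∧ ∀ (n : ℕ) (I : Set ℝ),
    MaximalIntervalOfContinuity T n I → c₀ ≤ (volume (T^[n] '' I)).toReal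

/-- An expanding system on the unit interval, which the disjoint open intervals `P i` cover up to a
countable set: `T` restricted to each `P i` is continuous and monotone, expands distances by at
least `lam`, and its difference quotients are comparable to the slope `D i` up to a factor
`exp (L * δ)` on sets of diameter `δ`. -/
structure ExpandingSystem (ι : Type) where
  T : ℝ → ℝ
  P : ι → Set ℝ
  D : ι → ℝ → ℝ
  lam : ℝ
  L : ℝ
  one_lt_lam : 1 < lam
  L_nonneg : 0 ≤ L
  isOpen_P : ∀ i, IsOpen (P i)
  ordConnected_P : ∀ i, (P i).OrdConnected
  P_subset : ∀ i, P i ⊆ Set.Ioo 0 1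
  eq_of_mem_P : ∀ i j x, x ∈ P i → x ∈ P j → i = j
  countable_compl : (Set.Icc (0 : ℝ) 1 \ ⋃ i, P i).Countable
  lam_le_D : ∀ i, ∀ x ∈ P i, lam ≤ D i x
  continuousOn_T : ∀ i, ContinuousOn T (P i)
  monotoneOn_or_antitoneOn : ∀ i, MonotoneOn T (P i) ∨ AntitoneOn T (P i)
  expand : ∀ i, ∀ x ∈ P i, ∀ y ∈ P i, lam * |x - y| ≤ |T x - T y|
  distortion : ∀ i, ∀ x ∈ P i, ∀ y ∈ P i, ∀ z ∈ P i, ∀ δ : ℝ,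
    |x - y| ≤ δ → |x - z| ≤ δ → |y - z| ≤ δ →
    Real.exp (-(L * δ)) * |x - y| ≤ (D i z)⁻¹ * |T x - T y| ∧
    (D i z)⁻¹ * |T x - T y| ≤ Real.exp (L * δ) * |x - y|

namespace ExpandingSystem

open MeasureTheory Set Filter Topology

section Words

variable (ι : Type) [Fintype ι]

/-- The words of length `n` in the alphabet `ι`. -/
def words : ℕ → Finset (List ι)
  | 0 => {[]}
  | n + 1 => ((Finset.univ : Finset ι) ×ˢ words n).map
      ⟨fun p => p.1 :: p.2, fun p q hpq => by
        simp only [List.cons.injEq] at hpq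
        exact Prod.ext hpq.1 hpq.2⟩

variable {ι}

lemma sum_words_succ (n : ℕ) (f : List ι → ℝ) :
    ∑ w ∈ words ι (n + 1), f w = ∑ i, ∑ w ∈ words ι n, f (i :: w) := by
  rw [words, Finset.sum_map, Finset.sum_product]
  rfl

lemma sum_words_add (n m : ℕ) (f : List ι → ℝ) :
    ∑ w ∈ words ι (n + m), f w = ∑ u ∈ words ι n, ∑ v ∈ words ι m, f (u ++ v) := by
  induction n generalizing f with
  | zero => simp [words]
  | succ n ih =>
    rw [Nat.succ_add, sum_words_succ, sum_words_succ]
    refine Finset.sum_congr rfl fun i _ => ?_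
    rw [ih]
    rfl

lemma cons_mem_words {n : ℕ} {i : ι} {w : List ι} :
    i :: w ∈ words ι (n + 1) ↔ w ∈ words ι n := by
  rw [words, Finset.mem_map]
  constructor
  · rintro ⟨p, hp, hpw⟩
    obtain ⟨-, rfl⟩ := List.cons.inj hpw
    exact (Finset.mem_product.1 hp).2
  · exact fun hw => ⟨(i, w), Finset.mem_product.2 ⟨Finset.mem_univ _, hw⟩, rfl⟩

lemma length_of_mem_words {n : ℕ} {w : List ι} (hw : w ∈ words ι n) : w.length = n := by
  induction n generalizing w with
  | zero => simp_all [words]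
  | succ n ih =>
    cases w with
    | nil => simp [words] at hw
    | cons i w => simpa using ih (cons_mem_words.1 hw)

lemma exists_append_of_mem_words {n m : ℕ} {w : List ι} (hw : w ∈ words ι (n + m)) :
    ∃ u ∈ words ι n, ∃ v ∈ words ι m, w = u ++ v := by
  induction n generalizing w with
  | zero => exact ⟨[], by simp [words], w, by simpa using hw, rfl⟩
  | succ n ih =>
    rw [Nat.succ_add] at hw
    cases w with
    | nil => simpa using length_of_mem_words hw
    | cons i w =>
      obtain ⟨u, hu, v, hv, rfl⟩ := ih (cons_mem_words.1 hw)
      exact ⟨i :: u, cons_mem_words.2 hu, v, hv, rfl⟩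

end Words

variable {ι : Type} (S : ExpandingSystem ι)

/-- The points of the unit interval whose itinerary starts with the given word. -/
def cyl : List ι → Set ℝ
  | [] => Ioo 0 1
  | i :: w => S.P i ∩ S.T ⁻¹' cyl w

/-- The reciprocal of the slope of the iterate of `T` along the given word. -/
noncomputable def invSlope : List ι → ℝ → ℝ
  | [], _ => 1
  | i :: w, x => (S.D i x)⁻¹ * invSlope w (S.T x)

/-- The largest reciprocal slope on a cylinder. -/
noncomputable def weight (w : List ι) : ℝ := ⨆ x : S.cyl w, S.invSlope w x

lemma lam_pos : 0 < S.lam := zero_lt_one.trans S.one_lt_lam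

lemma inv_lam_pos : 0 < S.lam⁻¹ := inv_pos.2 S.lam_pos

lemma inv_lam_lt_one : S.lam⁻¹ < 1 := inv_lt_one_of_one_lt₀ S.one_lt_lam

lemma inv_lam_pow_pos (n : ℕ) : 0 < S.lam⁻¹ ^ n := pow_pos S.inv_lam_pos n

lemma inv_lam_pow_le_one (n : ℕ) : S.lam⁻¹ ^ n ≤ 1 :=
  pow_le_one₀ S.inv_lam_pos.le S.inv_lam_lt_one.le

lemma cyl_subset (w : List ι) : S.cyl w ⊆ Ioo 0 1 := by
  cases w with
  | nil => exact subset_rfl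
  | cons i w => exact fun x hx => S.P_subset i hx.1

lemma mem_cyl_append (u v : List ι) (x : ℝ) :
    x ∈ S.cyl (u ++ v) ↔ x ∈ S.cyl u ∧ S.T^[u.length] x ∈ S.cyl v := by
  induction u generalizing x with
  | nil =>
    simp only [List.nil_append, List.length_nil, Function.iterate_zero, id, cyl]
    exact ⟨fun h => ⟨S.cyl_subset v h, h⟩, fun h => h.2⟩
  | cons i u ih =>
    simp only [List.cons_append, cyl, mem_inter_iff, mem_preimage, ih, List.length_cons,
      Function.iterate_succ_apply, and_assoc]

lemma iterate_mem_Ioo {w : List ι} {x : ℝ} (hx : x ∈ S.cyl w) :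
    S.T^[w.length] x ∈ Ioo (0 : ℝ) 1 := by
  have := (S.mem_cyl_append w [] x).1 (by simpa using hx)
  exact this.2

lemma isOpen_cyl (w : List ι) : IsOpen (S.cyl w) := by
  induction w with
  | nil => exact isOpen_Ioo
  | cons i w ih => exact (S.continuousOn_T i).isOpen_inter_preimage (S.isOpen_P i) ih

lemma ordConnected_cyl (w : List ι) : (S.cyl w).OrdConnected := by
  induction w with
  | nil => exact ordConnected_Ioo
  | cons i w ih =>
    refine ⟨fun x hx y hy z hz => ?_⟩
    have hzP : z ∈ S.P i := (S.ordConnected_P i).out hx.1 hy.1 hz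
    refine ⟨hzP, ?_⟩
    rcases S.monotoneOn_or_antitoneOn i with hm | hm
    · exact ih.out hx.2 hy.2 ⟨hm hx.1 hzP hz.1, hm hzP hy.1 hz.2⟩
    · exact ih.out hy.2 hx.2 ⟨hm hzP hy.1 hz.2, hm hx.1 hzP hz.1⟩

lemma measurableSet_cyl (w : List ι) : MeasurableSet (S.cyl w) := (S.isOpen_cyl w).measurableSet

lemma pow_lam_mul_le {w : List ι} {x y : ℝ} (hx : x ∈ S.cyl w) (hy : y ∈ S.cyl w) :
    S.lam ^ w.length * |x - y| ≤ |S.T^[w.length] x - S.T^[w.length] y| := by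
  induction w generalizing x y with
  | nil => simp
  | cons i w ih =>
    have h1 := S.expand i x hx.1 y hy.1
    have h2 := ih hx.2 hy.2
    simp only [List.length_cons, Function.iterate_succ_apply]
    calc S.lam ^ (w.length + 1) * |x - y| = S.lam ^ w.length * (S.lam * |x - y|) := by ring
      _ ≤ S.lam ^ w.length * |S.T x - S.T y| := by
        have := S.lam_pos
        gcongr
      _ ≤ _ := h2

lemma abs_sub_le_pow {w : List ι} {x y : ℝ} (hx : x ∈ S.cyl w) (hy : y ∈ S.cyl w) :
    |x - y| ≤ S.lam⁻¹ ^ w.length := by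
  have h1 := S.pow_lam_mul_le hx hy
  have h2 := S.iterate_mem_Ioo hx
  have h3 := S.iterate_mem_Ioo hy
  have h4 : |S.T^[w.length] x - S.T^[w.length] y| ≤ 1 :=
    abs_sub_le_iff.2 ⟨by linarith [h2.2, h3.1], by linarith [h2.1, h3.2]⟩
  rw [inv_pow, ← one_div, le_div_iff₀ (pow_pos S.lam_pos _), mul_comm]
  exact h1.trans h4

lemma invSlope_pos {w : List ι} {x : ℝ} (hx : x ∈ S.cyl w) : 0 < S.invSlope w x := by
  induction w generalizing x with
  | nil => exact one_pos
  | cons i w ih =>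
    exact mul_pos (inv_pos.2 (S.lam_pos.trans_le (S.lam_le_D i x hx.1))) (ih hx.2)

lemma invSlope_le_pow {w : List ι} {x : ℝ} (hx : x ∈ S.cyl w) :
    S.invSlope w x ≤ S.lam⁻¹ ^ w.length := by
  induction w generalizing x with
  | nil => simp [invSlope]
  | cons i w ih =>
    have h1 : (S.D i x)⁻¹ ≤ S.lam⁻¹ := inv_anti₀ S.lam_pos (S.lam_le_D i x hx.1)
    simp only [invSlope, List.length_cons, pow_succ']
    exact mul_le_mul h1 (ih hx.2) (S.invSlope_pos hx.2).le S.inv_lam_pos.le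

lemma invSlope_append (u v : List ι) (x : ℝ) :
    S.invSlope (u ++ v) x = S.invSlope u x * S.invSlope v (S.T^[u.length] x) := by
  induction u generalizing x with
  | nil => simp [invSlope]
  | cons i u ih => simp [invSlope, ih, mul_assoc]

lemma invSlope_le_weight {w : List ι} {x : ℝ} (hx : x ∈ S.cyl w) :
    S.invSlope w x ≤ S.weight w :=
  le_ciSup (f := fun x : S.cyl w => S.invSlope w x)
    ⟨S.lam⁻¹ ^ w.length, by rintro _ ⟨x, rfl⟩; exact S.invSlope_le_pow x.2⟩ ⟨x, hx⟩

lemma weight_le {w : List ι} {b : ℝ} (hb : 0 ≤ b) (h : ∀ x ∈ S.cyl w, S.invSlope w x ≤ b) :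
    S.weight w ≤ b :=
  Real.iSup_le (fun x => h x x.2) hb

lemma weight_nonneg (w : List ι) : 0 ≤ S.weight w :=
  Real.iSup_nonneg fun x => (S.invSlope_pos x.2).le

lemma weight_le_pow (w : List ι) : S.weight w ≤ S.lam⁻¹ ^ w.length :=
  S.weight_le (S.inv_lam_pow_pos _).le fun _ hx => S.invSlope_le_pow hx

lemma weight_le_one (w : List ι) : S.weight w ≤ 1 :=
  (S.weight_le_pow w).trans (S.inv_lam_pow_le_one _)

lemma weight_append_le (u v : List ι) : S.weight (u ++ v) ≤ S.weight u * S.weight v := by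
  refine S.weight_le (mul_nonneg (S.weight_nonneg u) (S.weight_nonneg v)) fun x hx => ?_
  rw [mem_cyl_append] at hx
  rw [invSlope_append]
  exact mul_le_mul (S.invSlope_le_weight hx.1) (S.invSlope_le_weight hx.2)
    (S.invSlope_pos hx.2).le (S.weight_nonneg u)

lemma distortion_aux {w : List ι} {x y z : ℝ} (hx : x ∈ S.cyl w) (hy : y ∈ S.cyl w)
    (hz : z ∈ S.cyl w) :
    Real.exp (-(S.L * ((1 - S.lam⁻¹ ^ w.length) / (S.lam - 1)))) * |x - y| ≤
        S.invSlope w z * |S.T^[w.length] x - S.T^[w.length] y| ∧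
      S.invSlope w z * |S.T^[w.length] x - S.T^[w.length] y| ≤
        Real.exp (S.L * ((1 - S.lam⁻¹ ^ w.length) / (S.lam - 1))) * |x - y| := by
  induction w generalizing x y z with
  | nil => simp [invSlope]
  | cons i w ih =>
    have hne : S.lam - 1 ≠ 0 := (sub_pos.2 S.one_lt_lam).ne'
    have hne' : S.lam ≠ 0 := S.lam_pos.ne'
    have hD := S.distortion i x hx.1 y hy.1 z hz.1 (S.lam⁻¹ ^ (w.length + 1))
      (S.abs_sub_le_pow hx hy) (S.abs_sub_le_pow hx hz) (S.abs_sub_le_pow hy hz)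
    have ih := ih hx.2 hy.2 hz.2
    have hsum : S.L * ((1 - S.lam⁻¹ ^ (w.length + 1)) / (S.lam - 1)) =
        S.L * ((1 - S.lam⁻¹ ^ w.length) / (S.lam - 1)) + S.L * S.lam⁻¹ ^ (w.length + 1) := by
      rw [← mul_add, pow_succ]
      congr 1
      field_simp
      ring
    have hDpos : 0 ≤ (S.D i z)⁻¹ :=
      (inv_pos.2 (S.lam_pos.trans_le (S.lam_le_D i z hz.1))).le
    simp only [List.length_cons, Function.iterate_succ_apply, invSlope, hsum, neg_add,
      Real.exp_add]
    set E := S.L * ((1 - S.lam⁻¹ ^ w.length) / (S.lam - 1))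
    constructor
    · calc _ = Real.exp (-E) * (Real.exp (-(S.L * S.lam⁻¹ ^ (w.length + 1))) * |x - y|) := by ring
        _ ≤ Real.exp (-E) * ((S.D i z)⁻¹ * |S.T x - S.T y|) :=
          mul_le_mul_of_nonneg_left hD.1 (Real.exp_pos _).le
        _ = (S.D i z)⁻¹ * (Real.exp (-E) * |S.T x - S.T y|) := by ring
        _ ≤ _ := by rw [mul_assoc]; exact mul_le_mul_of_nonneg_left ih.1 hDpos
    · calc _ = (S.D i z)⁻¹ * (S.invSlope w (S.T z) *
            |S.T^[w.length] (S.T x) - S.T^[w.length] (S.T y)|) := by ring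
        _ ≤ (S.D i z)⁻¹ * (Real.exp E * |S.T x - S.T y|) := mul_le_mul_of_nonneg_left ih.2 hDpos
        _ = Real.exp E * ((S.D i z)⁻¹ * |S.T x - S.T y|) := by ring
        _ ≤ Real.exp E * (Real.exp (S.L * S.lam⁻¹ ^ (w.length + 1)) * |x - y|) :=
          mul_le_mul_of_nonneg_left hD.2 (Real.exp_pos _).le
        _ = _ := by ring

/-- The bound for the distortion of all iterates on cylinders. -/
noncomputable def K : ℝ := Real.exp (S.L / (S.lam - 1))

lemma one_le_K : 1 ≤ S.K :=
  Real.one_le_exp (div_nonneg S.L_nonneg (sub_pos.2 S.one_lt_lam).le)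

lemma K_pos : 0 < S.K := Real.exp_pos _

lemma exp_le_K (n : ℕ) :
    Real.exp (S.L * ((1 - S.lam⁻¹ ^ n) / (S.lam - 1))) ≤ S.K := by
  refine Real.exp_le_exp.2 ?_
  rw [← mul_div_assoc]
  refine div_le_div_of_nonneg_right ?_ (sub_pos.2 S.one_lt_lam).le
  exact mul_le_of_le_one_right S.L_nonneg (by linarith [S.inv_lam_pow_pos n])

lemma abs_sub_le_weight {w : List ι} {x y : ℝ} (hx : x ∈ S.cyl w) (hy : y ∈ S.cyl w) :
    |x - y| ≤ S.K * S.weight w * |S.T^[w.length] x - S.T^[w.length] y| := by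
  have h1 := (S.distortion_aux hx hy hx).1
  have h2 := S.exp_le_K w.length
  set E := S.L * ((1 - S.lam⁻¹ ^ w.length) / (S.lam - 1))
  have h3 : |x - y| = Real.exp E * (Real.exp (-E) * |x - y|) := by
    rw [← mul_assoc, ← Real.exp_add]; simp
  rw [h3, mul_assoc]
  refine mul_le_mul h2 (h1.trans ?_) (by positivity) S.K_pos.le
  exact mul_le_mul_of_nonneg_right (S.invSlope_le_weight hx) (abs_nonneg _)

lemma weight_mul_le {w : List ι} {x y : ℝ} (hx : x ∈ S.cyl w) (hy : y ∈ S.cyl w) :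
    S.weight w * |S.T^[w.length] x - S.T^[w.length] y| ≤ S.K * |x - y| := by
  rcases eq_or_ne x y with rfl | hxy
  · simp
  have hpos : 0 < |S.T^[w.length] x - S.T^[w.length] y| :=
    lt_of_lt_of_le (mul_pos (pow_pos S.lam_pos _) (abs_pos.2 (sub_ne_zero.2 hxy)))
      (S.pow_lam_mul_le hx hy)
  rw [← le_div_iff₀ hpos]
  refine S.weight_le (by have := S.K_pos; positivity) fun z hz => ?_
  rw [le_div_iff₀ hpos]
  exact (S.distortion_aux hx hy hz).2.trans
    (mul_le_mul_of_nonneg_right (S.exp_le_K _) (abs_nonneg _))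

lemma weight_pos {w : List ι} (h : (S.cyl w).Nonempty) : 0 < S.weight w :=
  let ⟨_, hx⟩ := h
  (S.invSlope_pos hx).trans_le (S.invSlope_le_weight hx)

lemma weight_eq_zero {w : List ι} (h : ¬ (S.cyl w).Nonempty) : S.weight w = 0 :=
  le_antisymm (S.weight_le le_rfl fun x hx => (h ⟨x, hx⟩).elim) (S.weight_nonneg w)

lemma continuousOn_iterate (w : List ι) : ContinuousOn (S.T^[w.length]) (S.cyl w) := by
  induction w with
  | nil => exact continuousOn_id
  | cons i w ih =>
    rw [List.length_cons, Function.iterate_succ]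
    exact ih.comp ((S.continuousOn_T i).mono inter_subset_left) fun x hx => hx.2

lemma ordConnected_image (w : List ι) : (S.T^[w.length] '' S.cyl w).OrdConnected :=
  ((S.ordConnected_cyl w).isPreconnected.image _ (S.continuousOn_iterate w)).ordConnected

lemma eq_of_mem_cyl {n : ℕ} [Fintype ι] {v w : List ι} (hv : v ∈ words ι n) (hw : w ∈ words ι n)
    {x : ℝ} (hxv : x ∈ S.cyl v) (hxw : x ∈ S.cyl w) : v = w := by
  have hlen := (length_of_mem_words hv).trans (length_of_mem_words hw).symm
  clear hv hw
  induction v generalizing w x with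
  | nil => exact (List.length_eq_zero_iff.1 hlen.symm).symm
  | cons i v ih =>
    cases w with
    | nil => simp at hlen
    | cons j w =>
      rw [S.eq_of_mem_P i j x hxv.1 hxw.1, ih hxv.2 hxw.2 (by simpa using hlen)]

lemma sInf_mem_or_sSup_mem {U J : Set ℝ} (hU : U.OrdConnected) (hJ : J.OrdConnected)
    (hJb : BddBelow J) (hJa : BddAbove J) (hUJ : (U ∩ J).Nonempty) (hn : ¬ U ⊆ J) :
    sInf J ∈ U ∨ sSup J ∈ U := by
  obtain ⟨y, hyU, hyJ⟩ := not_subset.1 hn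
  obtain ⟨z, hzU, hzJ⟩ := hUJ
  rcases lt_or_ge y z with hyz | hyz
  · refine Or.inl (hU.out hyU hzU ⟨le_csInf ⟨z, hzJ⟩ fun j hj => ?_, csInf_le hJb hzJ⟩)
    by_contra hjy
    exact hyJ (hJ.out hj hzJ ⟨(not_le.1 hjy).le, hyz.le⟩)
  · refine Or.inr (hU.out hzU hyU ⟨le_csSup hJa hzJ, csSup_le ⟨z, hzJ⟩ fun j hj => ?_⟩)
    by_contra hjy
    exact hyJ (hJ.out hzJ hj ⟨hyz, (not_le.1 hjy).le⟩)

lemma abs_sub_le_volume {X : Set ℝ} (hX : X.OrdConnected) (hfin : volume X ≠ ⊤) {x y : ℝ}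
    (hx : x ∈ X) (hy : y ∈ X) : |x - y| ≤ volume.real X := by
  calc |x - y| = volume.real (uIcc x y) := by
        rw [measureReal_def, Real.volume_interval, ENNReal.toReal_ofReal (abs_nonneg _),
          abs_sub_comm]
    _ ≤ _ := measureReal_mono (hX.uIcc_subset hx hy) hfin

lemma volume_cyl_ne_top (w : List ι) : volume (S.cyl w) ≠ ⊤ :=
  measure_ne_top_of_subset (S.cyl_subset w) (by simp)

lemma exists_inv_lam_pow_lt {ε : ℝ} (hε : 0 < ε) : ∃ p : ℕ, 0 < p ∧ S.lam⁻¹ ^ p < ε := by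
  obtain ⟨p, hp⟩ := exists_pow_lt_of_lt_one hε S.inv_lam_lt_one
  refine ⟨p + 1, p.succ_pos, lt_of_le_of_lt ?_ hp⟩
  exact pow_le_pow_of_le_one S.inv_lam_pos.le S.inv_lam_lt_one.le p.le_succ

open scoped Classical

variable [Fintype ι]

lemma sum_ite_mem_le (n : ℕ) (x : ℝ) {t : ℝ} (ht : 0 ≤ t) :
    ∑ w ∈ words ι n, (if x ∈ S.cyl w then t else 0) ≤ t := by
  rw [← Finset.sum_filter, Finset.sum_const, nsmul_eq_mul]
  have : ((words ι n).filter fun w => x ∈ S.cyl w).card ≤ 1 := by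
    refine Finset.card_le_one.2 fun v hv w hw => ?_
    rw [Finset.mem_filter] at hv hw
    exact S.eq_of_mem_cyl hv.1 hw.1 hv.2 hw.2
  exact mul_le_of_le_one_left ht (by exact_mod_cast this)

lemma sum_boundary_le (n : ℕ) {J : Set ℝ} (hJ : J.OrdConnected) (hJb : BddBelow J)
    (hJa : BddAbove J) {f : List ι → ℝ} {t : ℝ} (ht : 0 ≤ t) (hf : ∀ w ∈ words ι n, f w ≤ t) :
    ∑ w ∈ words ι n with (S.cyl w ∩ J).Nonempty ∧ ¬ S.cyl w ⊆ J, f w ≤ 2 * t := by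
  rw [Finset.sum_filter]
  calc _ ≤ ∑ w ∈ words ι n, ((if sInf J ∈ S.cyl w then t else 0) +
        (if sSup J ∈ S.cyl w then t else 0)) := by
        refine Finset.sum_le_sum fun w hw => ?_
        split_ifs with h h1 h2 h2 <;> try linarith [hf w hw]
        exact absurd (sInf_mem_or_sSup_mem (S.ordConnected_cyl w) hJ hJb hJa h.1 h.2)
          (not_or.2 ⟨h1, h2⟩)
    _ ≤ 2 * t := by
      rw [Finset.sum_add_distrib, two_mul]
      exact add_le_add (S.sum_ite_mem_le n _ ht) (S.sum_ite_mem_le n _ ht)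

/-- The total weight of the cylinders of length `n` that meet `B`. -/
noncomputable def hitSum (n : ℕ) (B : Set ℝ) : ℝ :=
  ∑ w ∈ words ι n with (S.cyl w ∩ B).Nonempty, S.weight w

lemma hitSum_nonneg (n : ℕ) (B : Set ℝ) : 0 ≤ S.hitSum n B :=
  Finset.sum_nonneg fun w _ => S.weight_nonneg w

lemma sum_nonfull_le (n p : ℕ) (B : Set ℝ) :
    ∑ u ∈ words ι n with (S.cyl u ∩ B).Nonempty,
      ∑ v ∈ words ι p with (S.cyl (u ++ v)).Nonempty ∧ ¬ S.cyl v ⊆ S.T^[n] '' S.cyl u,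
        S.weight (u ++ v) ≤ 2 * S.lam⁻¹ ^ p * S.hitSum n B := by
  rw [hitSum, Finset.mul_sum]
  refine Finset.sum_le_sum fun u hu => ?_
  have hlen := length_of_mem_words (Finset.mem_filter.1 hu).1
  have hJ : S.T^[n] '' S.cyl u ⊆ Ioo 0 1 := by
    rintro _ ⟨x, hx, rfl⟩
    exact hlen ▸ S.iterate_mem_Ioo hx
  have ht : 0 ≤ S.weight u * S.lam⁻¹ ^ p :=
    mul_nonneg (S.weight_nonneg u) (S.inv_lam_pow_pos p).le
  have key := S.sum_boundary_le p (J := S.T^[n] '' S.cyl u) (hlen ▸ S.ordConnected_image u)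
    (bddBelow_Ioo.mono hJ) (bddAbove_Ioo.mono hJ) (f := fun v => S.weight (u ++ v)) ht
    fun v hv => (S.weight_append_le u v).trans
      (mul_le_mul_of_nonneg_left ((S.weight_le_pow v).trans_eq
        (by rw [length_of_mem_words hv])) (S.weight_nonneg u))
  calc _ ≤ _ := Finset.sum_le_sum_of_subset_of_nonneg (fun v hv => ?_)
        fun v _ _ => S.weight_nonneg _
    _ ≤ _ := key
    _ = _ := by ring
  rw [Finset.mem_filter] at hv ⊢
  obtain ⟨hv, ⟨x, hx⟩, hf⟩ := hv
  rw [mem_cyl_append, hlen] at hx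
  exact ⟨hv, ⟨_, hx.2, x, hx.1, rfl⟩, hf⟩

lemma sum_volume_le (n : ℕ) {B : Set ℝ} (hB : volume B ≠ ⊤) :
    ∑ w ∈ words ι n with S.cyl w ⊆ B, volume.real (S.cyl w) ≤ volume.real B := by
  rw [← measureReal_biUnion_finset (h := fun w _ => S.volume_cyl_ne_top w)]
  · exact measureReal_mono (iUnion₂_subset fun w hw => (Finset.mem_filter.1 hw).2) hB
  · intro v hv w hw hne
    refine Set.disjoint_left.2 fun x hxv hxw => hne ?_
    exact S.eq_of_mem_cyl (Finset.mem_filter.1 hv).1 (Finset.mem_filter.1 hw).1 hxv hxw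
  · exact fun w _ => S.measurableSet_cyl w

lemma exists_full_le (p : ℕ) : ∃ δ > 0, ∀ u : List ι, ∀ v ∈ words ι p,
    S.cyl v ⊆ S.T^[u.length] '' S.cyl u → S.weight (u ++ v) * δ ≤ volume.real (S.cyl (u ++ v)) := by
  suffices h : ∀ᶠ δ in 𝓝[>] (0 : ℝ), ∀ v ∈ words ι p, ∀ u : List ι,
      S.cyl v ⊆ S.T^[u.length] '' S.cyl u →
        S.weight (u ++ v) * δ ≤ volume.real (S.cyl (u ++ v)) by
    obtain ⟨δ, hδ, h⟩ := (h.and self_mem_nhdsWithin).exists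
    exact ⟨δ, h, fun u v hv => hδ v hv u⟩
  refine (Filter.eventually_all_finset _).2 fun v hv => ?_
  by_cases hne : (S.cyl v).Nonempty
  · obtain ⟨x, hx⟩ := hne
    obtain ⟨ε, hε, hball⟩ := Metric.isOpen_iff.1 (S.isOpen_cyl v) x hx
    have hy : x + ε / 2 ∈ S.cyl v := hball (by
      rw [Metric.mem_ball, Real.dist_eq, add_sub_cancel_left, abs_of_pos (by positivity)]
      linarith)
    set y := x + ε / 2 with hydef
    have hd : 0 < |S.T^[v.length] x - S.T^[v.length] y| :=
      lt_of_lt_of_le (mul_pos (pow_pos S.lam_pos _) (abs_pos.2 (by rw [hydef]; linarith)))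
        (S.pow_lam_mul_le hx hy)
    filter_upwards [Ioc_mem_nhdsGT (div_pos hd S.K_pos)] with δ hδ u hu
    obtain ⟨x', hx', hxx'⟩ := hu hx
    obtain ⟨y', hy', hyy'⟩ := hu hy
    have hx'' : x' ∈ S.cyl (u ++ v) := (S.mem_cyl_append u v x').2 ⟨hx', hxx' ▸ hx⟩
    have hy'' : y' ∈ S.cyl (u ++ v) := (S.mem_cyl_append u v y').2 ⟨hy', hyy' ▸ hy⟩
    have h1 := S.weight_mul_le hx'' hy''
    rw [List.length_append, add_comm, Function.iterate_add_apply, Function.iterate_add_apply,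
      hxx', hyy'] at h1
    have h2 := abs_sub_le_volume (S.ordConnected_cyl _) (S.volume_cyl_ne_top _) hx'' hy''
    calc S.weight (u ++ v) * δ
        ≤ S.weight (u ++ v) * (|S.T^[v.length] x - S.T^[v.length] y| / S.K) :=
          mul_le_mul_of_nonneg_left hδ.2 (S.weight_nonneg _)
      _ ≤ |x' - y'| := by
          rw [← mul_div_assoc, div_le_iff₀ S.K_pos, mul_comm |x' - y'|]
          exact h1
      _ ≤ _ := h2
  · refine Filter.Eventually.of_forall fun δ u _ => ?_
    rw [S.weight_eq_zero, zero_mul]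
    · exact measureReal_nonneg
    · rintro ⟨x, hx⟩
      exact hne ⟨_, ((S.mem_cyl_append u v x).1 hx).2⟩

/-- The image under `T^[n]` of the cylinder of the first `n` letters of `w` contains the cylinder of
the remaining letters. -/
def IsFull (n : ℕ) (w : List ι) : Prop := S.cyl (w.drop n) ⊆ S.T^[n] '' S.cyl (w.take n)

lemma isFull_append {n : ℕ} {u : List ι} (hu : u ∈ words ι n) (v : List ι) :
    S.IsFull n (u ++ v) ↔ S.cyl v ⊆ S.T^[n] '' S.cyl u := by
  rw [IsFull, List.take_left' (length_of_mem_words hu), List.drop_left' (length_of_mem_words hu)]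

lemma sum_le_sum_full_add (n p : ℕ) {B : Set ℝ} (hB : B.OrdConnected) (hBb : BddBelow B)
    (hBa : BddAbove B) {Q : List ι → Prop} (hQ : ∀ w, Q w → (S.cyl w ∩ B).Nonempty) :
    ∑ w ∈ words ι (n + p) with Q w, S.weight w ≤
      ∑ w ∈ words ι (n + p) with Q w ∧ S.IsFull n w ∧ S.cyl w ⊆ B, S.weight w +
        2 * S.lam⁻¹ ^ (n + p) + 2 * S.lam⁻¹ ^ p * S.hitSum n B := by
  have h2 := S.sum_boundary_le (n + p) hB hBb hBa (f := S.weight)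
    (S.inv_lam_pow_pos (n + p)).le
    fun w hw => (S.weight_le_pow w).trans_eq (by rw [length_of_mem_words hw])
  have h3 := S.sum_nonfull_le n p B
  refine le_trans ?_ (add_le_add (add_le_add le_rfl h2) h3)
  simp only [Finset.sum_filter]
  rw [sum_words_add, sum_words_add, sum_words_add, ← Finset.sum_add_distrib,
    ← Finset.sum_add_distrib]
  refine Finset.sum_le_sum fun u hu => ?_
  have hlen := length_of_mem_words hu
  rw [← Finset.sum_add_distrib]
  by_cases hhit : (S.cyl u ∩ B).Nonempty
  · rw [if_pos hhit, ← Finset.sum_add_distrib]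
    refine Finset.sum_le_sum fun v hv => ?_
    have hw := S.weight_nonneg (u ++ v)
    rw [S.isFull_append hu]
    by_cases hwQ : Q (u ++ v)
    · have hwB := hQ _ hwQ
      by_cases hsub : S.cyl (u ++ v) ⊆ B
      · by_cases hfl : S.cyl v ⊆ S.T^[n] '' S.cyl u
        · simp [hwQ, hsub, hfl]
        · simp [hwQ, hsub, hfl, hwB.mono inter_subset_left]
      · rw [if_pos hwQ, if_neg (fun h => hsub h.2.2), if_pos ⟨hwB, hsub⟩]
        split_ifs <;> linarith
    · rw [if_neg hwQ]
      refine add_nonneg (add_nonneg ?_ ?_) ?_ <;> split_ifs <;> first | assumption | exact le_rfl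
  · rw [if_neg hhit, add_zero]
    refine Finset.sum_le_sum fun v hv => ?_
    rw [if_neg]
    · have hw := S.weight_nonneg (u ++ v)
      refine add_nonneg ?_ ?_ <;> split_ifs <;> first | assumption | exact le_rfl
    · intro hwQ
      obtain ⟨x, hx, hxB⟩ := hQ _ hwQ
      exact hhit ⟨x, ((S.mem_cyl_append u v x).1 hx).1, hxB⟩

lemma hitSum_add_le {p : ℕ} {δ : ℝ} (hδ : 0 < δ)
    (hfull : ∀ u : List ι, ∀ v ∈ words ι p, S.cyl v ⊆ S.T^[u.length] '' S.cyl u →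
      S.weight (u ++ v) * δ ≤ volume.real (S.cyl (u ++ v)))
    (n : ℕ) {B : Set ℝ} (hB : B.OrdConnected) (hBb : BddBelow B) (hBa : BddAbove B)
    (hBfin : volume B ≠ ⊤) :
    S.hitSum (n + p) B ≤
      δ⁻¹ * volume.real B + 2 * S.lam⁻¹ ^ (n + p) + 2 * S.lam⁻¹ ^ p * S.hitSum n B := by
  refine (S.sum_le_sum_full_add n p hB hBb hBa fun w hw => hw).trans ?_
  gcongr
  refine le_trans ?_ (mul_le_mul_of_nonneg_left (S.sum_volume_le (n + p) hBfin)
    (inv_pos.2 hδ).le)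
  rw [Finset.mul_sum, Finset.sum_filter, Finset.sum_filter]
  refine Finset.sum_le_sum fun w hw => ?_
  obtain ⟨u, hu, v, hv, rfl⟩ := exists_append_of_mem_words hw
  have hvol : 0 ≤ δ⁻¹ * volume.real (S.cyl (u ++ v)) := by positivity
  have hf := hfull u v hv
  rw [length_of_mem_words hu, ← S.isFull_append hu, mul_comm, ← le_inv_mul_iff₀ hδ] at hf
  by_cases hsub : S.cyl (u ++ v) ⊆ B
  · rw [if_pos hsub]
    split_ifs with h
    · exact hf h.2.1
    · exact hvol
  · rw [if_neg hsub, if_neg fun h => hsub h.2.2]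

/-- The growth lemma: cylinders meeting an interval `B` have total weight comparable to the length
of `B`, up to an exponentially small error. -/
lemma exists_hitSum_le : ∃ C θ : ℝ, 0 < C ∧ 0 < θ ∧ θ < 1 ∧ S.lam⁻¹ ≤ θ ∧
    ∀ (n : ℕ) (B : Set ℝ), B.OrdConnected → BddBelow B → BddAbove B →
      S.hitSum n B ≤ C * (volume.real B + θ ^ n) := by
  obtain ⟨p, hp, hp8⟩ := S.exists_inv_lam_pow_lt (ε := 1 / 8) (by norm_num)
  obtain ⟨δ, hδ, hfull⟩ := S.exists_full_le p
  obtain ⟨θ, hθ0, hθ1, hθp⟩ : ∃ θ : ℝ, 0 < θ ∧ θ < 1 ∧ θ ^ p = 1 / 2 :=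
    ⟨(1 / 2 : ℝ) ^ ((p : ℝ)⁻¹), by positivity,
      Real.rpow_lt_one (by norm_num) (by norm_num) (by positivity),
      Real.rpow_inv_natCast_pow (by norm_num) hp.ne'⟩
  have hlamθ : S.lam⁻¹ ≤ θ := by
    refine le_of_pow_le_pow_left₀ hp.ne' hθ0.le ?_
    rw [hθp]; linarith
  obtain ⟨M, hM0, hM⟩ : ∃ M : ℝ, 0 ≤ M ∧ ∀ n < p, ((words ι n).card : ℝ) ≤ M :=
    ⟨∑ k ∈ Finset.range p, ((words ι k).card : ℝ), Finset.sum_nonneg fun k _ => Nat.cast_nonneg _,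
      fun n hn => Finset.single_le_sum (f := fun k => ((words ι k).card : ℝ))
        (fun k _ => Nat.cast_nonneg _) (Finset.mem_range.2 hn)⟩
  have hδ' : 0 < δ⁻¹ := inv_pos.2 hδ
  refine ⟨2 * δ⁻¹ + (2 * M + 4), θ, by positivity, hθ0, hθ1, hlamθ, fun n B hB hBb hBa => ?_⟩
  have hV : 0 ≤ volume.real B := measureReal_nonneg
  have hBfin : volume B ≠ ⊤ :=
    (Metric.isBounded_of_bddAbove_of_bddBelow hBa hBb).measure_lt_top.ne
  suffices h : S.hitSum n B ≤ 2 * δ⁻¹ * volume.real B + (2 * M + 4) * θ ^ n by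
    have h1 : 0 ≤ 2 * δ⁻¹ * θ ^ n := by positivity
    have h2 : 0 ≤ (2 * M + 4) * volume.real B := by positivity
    linarith
  induction n using Nat.strong_induction_on with
  | _ n ih =>
    rcases lt_or_ge n p with hn | hn
    · have h1 : S.hitSum n B ≤ (words ι n).card := by
        rw [hitSum]
        calc _ ≤ ∑ w ∈ words ι n, S.weight w :=
              Finset.sum_le_sum_of_subset_of_nonneg (Finset.filter_subset _ _)
                fun w _ _ => S.weight_nonneg w
          _ ≤ ∑ w ∈ words ι n, (1 : ℝ) := Finset.sum_le_sum fun w _ => S.weight_le_one w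
          _ = _ := by simp
      have h2 := hM n hn
      have h3 : 1 / 2 ≤ θ ^ n := by
        rw [← hθp]
        exact pow_le_pow_of_le_one hθ0.le hθ1.le hn.le
      have h4 : 0 ≤ 2 * δ⁻¹ * volume.real B := by positivity
      nlinarith
    · obtain ⟨k, rfl⟩ := Nat.exists_eq_add_of_le' hn
      have h1 := S.hitSum_add_le hδ hfull k hB hBb hBa hBfin
      have h2 := ih k (by omega)
      have h3 : S.lam⁻¹ ^ (k + p) ≤ θ ^ (k + p) := pow_le_pow_left₀ S.inv_lam_pos.le hlamθ _
      have h4 : θ ^ k = 2 * θ ^ (k + p) := by rw [pow_add, hθp]; ring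
      have h5 : 2 * S.lam⁻¹ ^ p * S.hitSum k B ≤
          1 / 4 * (2 * δ⁻¹ * volume.real B + (2 * M + 4) * θ ^ k) := by
        refine mul_le_mul (by linarith) h2 (S.hitSum_nonneg _ _) (by norm_num)
      have h6 : 0 ≤ M * θ ^ (k + p) := by positivity
      have h7 : 0 ≤ δ⁻¹ * volume.real B := by positivity
      rw [h4] at h5
      linarith

omit [Fintype ι] in
lemma volume_real_le {X : Set ℝ} {d : ℝ} (hd : 0 ≤ d) (h : ∀ x ∈ X, ∀ y ∈ X, |x - y| ≤ d) :
    volume.real X ≤ d := by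
  refine ENNReal.toReal_le_of_le_ofReal hd ((Real.volume_le_diam X).trans
    (Metric.ediam_le fun x hx y hy => ?_))
  rw [edist_dist, Real.dist_eq]
  exact ENNReal.ofReal_le_ofReal (h x hx y hy)

/-- The set of points that are moved by less than `ρ` by the `n`-th iterate. -/
def near (n : ℕ) (ρ : ℝ) : Set ℝ := {x | |S.T^[n] x - x| < ρ}

omit [Fintype ι] in
lemma volume_near_le {w : List ι} (hw : w ≠ []) {ρ : ℝ} (hρ : 0 ≤ ρ) :
    volume.real (S.cyl w ∩ S.near w.length ρ) ≤
      2 * S.K / (1 - S.lam⁻¹) * ρ * S.weight w := by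
  have h1 : 0 < 1 - S.lam⁻¹ := sub_pos.2 S.inv_lam_lt_one
  have hK := S.K_pos
  have hwt := S.weight_nonneg w
  refine volume_real_le (by positivity) fun x hx y hy => ?_
  have hd := S.abs_sub_le_weight hx.1 hy.1
  have he := S.pow_lam_mul_le hx.1 hy.1
  have hlen : w.length ≠ 0 := by simpa using hw
  have hpow : S.lam ≤ S.lam ^ w.length := le_self_pow₀ S.one_lt_lam.le hlen
  have hx2 : |S.T^[w.length] x - x| < ρ := hx.2
  have hy2 : |S.T^[w.length] y - y| < ρ := hy.2
  set b := |S.T^[w.length] x - S.T^[w.length] y| with hb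
  have h2 : S.lam * |x - y| ≤ b :=
    (mul_le_mul_of_nonneg_right hpow (abs_nonneg _)).trans he
  have h3 : |x - y| ≤ S.lam⁻¹ * b := by
    rw [le_inv_mul_iff₀ S.lam_pos]; exact h2
  have h4 : b ≤ 2 * ρ + |x - y| := by
    rw [hb]
    have e : S.T^[w.length] x - S.T^[w.length] y =
      (S.T^[w.length] x - x) - (S.T^[w.length] y - y) + (x - y) := by ring
    rw [e]
    refine (abs_add_le _ _).trans ?_
    have := abs_sub (S.T^[w.length] x - x) (S.T^[w.length] y - y)
    linarith
  have h5 : b ≤ 2 * ρ / (1 - S.lam⁻¹) := by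
    rw [le_div_iff₀ h1]; linarith
  calc |x - y| ≤ S.K * S.weight w * b := hd
    _ ≤ S.K * S.weight w * (2 * ρ / (1 - S.lam⁻¹)) := by gcongr
    _ = _ := by ring

lemma sum_return_le {C θ : ℝ} (hC : 0 < C) (hθ0 : 0 < θ) (hθ1 : θ < 1)
    (hgrow : ∀ (n : ℕ) (B : Set ℝ), B.OrdConnected → BddBelow B → BddAbove B →
      S.hitSum n B ≤ C * (volume.real B + θ ^ n)) (n m : ℕ) {ρ : ℝ} (hρ : 0 ≤ ρ) :
    ∑ w ∈ words ι (n + m) with (S.cyl w ∩ S.near n ρ).Nonempty, S.weight w ≤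
      4 * C ^ 2 * (ρ + S.lam⁻¹ ^ m + θ ^ n) := by
  have hlm := S.inv_lam_pow_pos m
  have hθn : 0 < θ ^ n := pow_pos hθ0 n
  have hθm : θ ^ m ≤ 1 := pow_le_one₀ hθ0.le hθ1.le
  have htot : ∑ v ∈ words ι m, S.weight v ≤ 2 * C := by
    have h1 := hgrow m (Ioo 0 1) ordConnected_Ioo bddBelow_Ioo bddAbove_Ioo
    have h2 : ∑ v ∈ words ι m, S.weight v = S.hitSum m (Ioo 0 1) := by
      rw [hitSum, Finset.sum_filter]
      refine Finset.sum_congr rfl fun v _ => ?_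
      rw [inter_eq_left.2 (S.cyl_subset v)]
      split_ifs with h
      · rfl
      · exact S.weight_eq_zero h
    have h3 : volume.real (Ioo (0 : ℝ) 1) = 1 := by simp
    rw [h3] at h1
    rw [h2]
    nlinarith
  rw [Finset.sum_filter, sum_words_add, Finset.sum_comm]
  calc _ ≤ ∑ v ∈ words ι m, S.weight v * (2 * C * (ρ + S.lam⁻¹ ^ m + θ ^ n)) := by
        refine Finset.sum_le_sum fun v hv => ?_
        by_cases hne : (S.cyl v).Nonempty
        · obtain ⟨z, hz⟩ := hne
          set R := ρ + S.lam⁻¹ ^ m with hR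
          have hB := hgrow n (Ioo (z - R) (z + R)) ordConnected_Ioo bddBelow_Ioo bddAbove_Ioo
          have hvol : volume.real (Ioo (z - R) (z + R)) = 2 * R := by
            rw [Real.volume_real_Ioo_of_le (by linarith)]; ring
          rw [hvol] at hB
          calc _ ≤ S.weight v * S.hitSum n (Ioo (z - R) (z + R)) := by
                rw [hitSum, Finset.sum_filter, Finset.mul_sum]
                refine Finset.sum_le_sum fun u hu => ?_
                have hu' := length_of_mem_words hu
                split_ifs with h1 h2
                · rw [mul_comm]; exact S.weight_append_le u v
                · obtain ⟨x, hx, hxn⟩ := h1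
                  rw [mem_cyl_append, hu'] at hx
                  refine (h2 ⟨x, hx.1, ?_⟩).elim
                  have h3 := S.abs_sub_le_pow hx.2 hz
                  rw [length_of_mem_words hv] at h3
                  have h4 : |S.T^[n] x - x| < ρ := hxn
                  rw [abs_le] at h3
                  rw [abs_lt] at h4
                  constructor <;> linarith
                · exact mul_nonneg (S.weight_nonneg _) (S.weight_nonneg _)
                · simp
            _ ≤ _ := by
              refine mul_le_mul_of_nonneg_left (hB.trans ?_) (S.weight_nonneg v)
              nlinarith
        · rw [S.weight_eq_zero hne, zero_mul]
          refine Finset.sum_nonpos fun u _ => ?_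
          rw [if_neg]
          rintro ⟨x, hx, -⟩
          exact hne ⟨_, ((S.mem_cyl_append u v x).1 hx).2⟩
    _ = (∑ v ∈ words ι m, S.weight v) * (2 * C * (ρ + S.lam⁻¹ ^ m + θ ^ n)) := by
        rw [Finset.sum_mul]
    _ ≤ 2 * C * (2 * C * (ρ + S.lam⁻¹ ^ m + θ ^ n)) := by gcongr
    _ = _ := by ring

section Measure

variable {μ : Measure ℝ}

lemma ae_exists_mem_cyl (hT : MeasurePreserving S.T μ μ) (hac : μ ≪ volume)
    (hsupp : ∀ᵐ x ∂μ, x ∈ Icc (0 : ℝ) 1) (n : ℕ) :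
    ∀ᵐ x ∂μ, ∃ w ∈ words ι n, x ∈ S.cyl w := by
  induction n with
  | zero =>
    have h01 : ∀ᵐ x ∂μ, x ∉ ({0, 1} : Set ℝ) :=
      measure_eq_zero_iff_ae_notMem.1 (hac ((Set.toFinite _).measure_zero _))
    filter_upwards [hsupp, h01] with x hx hx'
    simp only [mem_insert_iff, mem_singleton_iff, not_or] at hx'
    exact ⟨[], by simp [words], lt_of_le_of_ne hx.1 (Ne.symm hx'.1), lt_of_le_of_ne hx.2 hx'.2⟩
  | succ n ih =>
    have hc : ∀ᵐ x ∂μ, x ∉ Icc (0 : ℝ) 1 \ ⋃ i, S.P i :=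
      measure_eq_zero_iff_ae_notMem.1 (hac (S.countable_compl.measure_zero _))
    filter_upwards [hsupp, hc, hT.quasiMeasurePreserving.ae ih] with x hx hxc hTx
    obtain ⟨w, hw, hxw⟩ := hTx
    have hxP : x ∈ ⋃ i, S.P i := by
      by_contra h
      exact hxc ⟨hx, h⟩
    obtain ⟨i, hi⟩ := mem_iUnion.1 hxP
    exact ⟨i :: w, cons_mem_words.2 hw, hi, hxw⟩

lemma measureReal_le_sum [IsFiniteMeasure μ] {n : ℕ}
    (hcov : ∀ᵐ x ∂μ, ∃ w ∈ words ι n, x ∈ S.cyl w) (X : Set ℝ) :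
    μ.real X ≤ ∑ w ∈ words ι n, μ.real (S.cyl w ∩ X) := by
  refine le_trans ?_ (measureReal_biUnion_finset_le _ _)
  refine ENNReal.toReal_mono (measure_ne_top _ _) (measure_mono_ae ?_)
  filter_upwards [hcov] with x ⟨w, hw, hxw⟩ hxX
  exact mem_iUnion₂.2 ⟨w, hw, hxw, hxX⟩

omit [Fintype ι] in
lemma measurableSet_near (hT : Measurable S.T) (n : ℕ) (ρ : ℝ) : MeasurableSet (S.near n ρ) := by
  have := hT.iterate n
  exact measurableSet_lt (by fun_prop) measurable_const

lemma measure_return_le [IsFiniteMeasure μ] {c C θ : ℝ} (hc : 0 ≤ c) (hT : Measurable S.T)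
    (hle : ∀ X, MeasurableSet X → X ⊆ Icc 0 1 → μ.real X ≤ c * volume.real X)
    (hcov : ∀ n, ∀ᵐ x ∂μ, ∃ w ∈ words ι n, x ∈ S.cyl w)
    (hC : 0 < C) (hθ0 : 0 < θ) (hθ1 : θ < 1)
    (hgrow : ∀ (n : ℕ) (B : Set ℝ), B.OrdConnected → BddBelow B → BddAbove B →
      S.hitSum n B ≤ C * (volume.real B + θ ^ n))
    {n m : ℕ} (hnm : n + m ≠ 0) {ρ ρ' : ℝ} (hρ : 0 ≤ ρ) (hρ' : 0 ≤ ρ') :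
    μ.real (S.near n ρ ∩ S.near (n + m) ρ') ≤
      c * (2 * S.K / (1 - S.lam⁻¹)) * (4 * C ^ 2) * ρ' * (ρ + S.lam⁻¹ ^ m + θ ^ n) := by
  have hK := S.K_pos
  have h1 : 0 < 1 - S.lam⁻¹ := sub_pos.2 S.inv_lam_lt_one
  have hsum := S.sum_return_le hC hθ0 hθ1 hgrow n m hρ
  set Q := 2 * S.K / (1 - S.lam⁻¹) with hQ
  have hQ0 : 0 ≤ Q := by positivity
  calc _ ≤ _ := S.measureReal_le_sum (hcov (n + m)) _
    _ ≤ ∑ w ∈ words ι (n + m) with (S.cyl w ∩ S.near n ρ).Nonempty,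
        c * Q * ρ' * S.weight w := by
      rw [Finset.sum_filter]
      refine Finset.sum_le_sum fun w hw => ?_
      have hlen := length_of_mem_words hw
      split_ifs with h
      · have hne : w ≠ [] := by
          rintro rfl
          exact hnm hlen.symm
        have hv := S.volume_near_le hne hρ'
        rw [hlen] at hv
        calc _ ≤ μ.real (S.cyl w ∩ S.near (n + m) ρ') :=
              measureReal_mono (inter_subset_inter_right _ inter_subset_right)
          _ ≤ c * volume.real (S.cyl w ∩ S.near (n + m) ρ') :=
              hle _ ((S.measurableSet_cyl w).inter (S.measurableSet_near hT _ _))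
                fun x hx => Ioo_subset_Icc_self (S.cyl_subset w hx.1)
          _ ≤ c * (Q * ρ' * S.weight w) := mul_le_mul_of_nonneg_left hv hc
          _ = _ := by ring
      · rw [show S.cyl w ∩ (S.near n ρ ∩ S.near (n + m) ρ') = ∅ from ?_]
        · simp
        · refine eq_empty_of_forall_notMem fun x hx => h ⟨x, hx.1, hx.2.1⟩
    _ = c * Q * ρ' * ∑ w ∈ words ι (n + m) with (S.cyl w ∩ S.near n ρ).Nonempty, S.weight w := by
      rw [Finset.mul_sum]
    _ ≤ c * Q * ρ' * (4 * C ^ 2 * (ρ + S.lam⁻¹ ^ m + θ ^ n)) := by gcongr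
    _ = _ := by ring

omit [Fintype ι] in
lemma exists_Ioo_forall_subset_or_disjoint {α : Type} (F : Finset α) (I : α → Set ℝ)
    (hI : ∀ v, (I v).OrdConnected) :
    ∃ s t : ℝ, s < t ∧ Ioo s t ⊆ Ioo 0 1 ∧ ∀ v ∈ F, (Ioo s t ∩ I v).Nonempty → Ioo s t ⊆ I v := by
  induction F using Finset.induction_on with
  | empty => exact ⟨0, 1, one_pos, subset_rfl, by simp⟩
  | insert a F _ ih =>
    obtain ⟨s, t, hst, hsub, hF⟩ := ih
    suffices h : ∃ s' t', s' < t' ∧ Ioo s' t' ⊆ Ioo s t ∧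
        ((Ioo s' t' ∩ I a).Nonempty → Ioo s' t' ⊆ I a) by
      obtain ⟨s', t', hst', hsub', ha⟩ := h
      refine ⟨s', t', hst', hsub'.trans hsub, fun v hv hne => ?_⟩
      rcases Finset.mem_insert.1 hv with rfl | hv
      · exact ha hne
      · exact hsub'.trans (hF v hv (hne.mono (inter_subset_inter_left _ hsub')))
    by_cases h1 : (Ioo s ((s + t) / 2) ∩ I a).Nonempty
    · by_cases h2 : (Ioo ((s + t) / 2) t ∩ I a).Nonempty
      · obtain ⟨x, hx, hxI⟩ := h1
        obtain ⟨y, hy, hyI⟩ := h2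
        exact ⟨x, y, hx.2.trans hy.1, Ioo_subset_Ioo hx.1.le hy.2.le,
          fun _ => Ioo_subset_Icc_self.trans ((hI a).out hxI hyI)⟩
      · exact ⟨_, t, by linarith, Ioo_subset_Ioo (by linarith) le_rfl, fun h => (h2 h).elim⟩
    · exact ⟨s, _, by linarith, Ioo_subset_Ioo le_rfl (by linarith), fun h => (h1 h).elim⟩

omit [Fintype ι] in
lemma exists_abs_sub_le {U : Set ℝ} (hU : U.OrdConnected) (hne : U.Nonempty) (hb : BddBelow U)
    (ha : BddAbove U) {f : ℝ → ℝ} (hf : ContinuousOn f U) (hfU : U ⊆ f '' U) {ε : ℝ}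
    (hε : 0 < ε) : ∃ x ∈ U, |f x - x| ≤ ε := by
  obtain ⟨b, hbU, hbε⟩ := exists_lt_of_csInf_lt hne (lt_add_of_pos_right (sInf U) hε)
  obtain ⟨d, hdU, hdε⟩ := exists_lt_of_lt_csSup hne (sub_lt_self (sSup U) hε)
  obtain ⟨x, hxU, rfl⟩ := hfU hbU
  obtain ⟨y, hyU, rfl⟩ := hfU hdU
  have hx := csInf_le hb hxU
  have hy := le_csSup ha hyU
  by_cases h1 : -ε ≤ f x - x
  · exact ⟨x, hxU, abs_le.2 ⟨h1, by linarith⟩⟩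
  by_cases h2 : f y - y ≤ ε
  · exact ⟨y, hyU, abs_le.2 ⟨by linarith, h2⟩⟩
  obtain ⟨z, hz, hfz⟩ := hU.isPreconnected.intermediate_value₂ hxU hyU hf continuousOn_id
    (by simp only [id]; linarith) (by simp only [id]; linarith)
  exact ⟨z, hz, by rw [hfz]; simpa using hε.le⟩

omit [Fintype ι] in
lemma le_volume_near {w : List ι} {s t : ℝ} (hst : s < t) (hsub : S.cyl w ⊆ Ioo s t)
    (himg : Ioo s t ⊆ S.T^[w.length] '' S.cyl w) {ρ : ℝ} (hρ : 0 < ρ) :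
    S.weight w / (8 * S.K) * min (t - s) ρ ≤ volume.real (S.cyl w ∩ S.near w.length ρ) := by
  obtain ⟨x₁, hx₁, hTx₁⟩ := himg (show s + (t - s) / 4 ∈ Ioo s t by constructor <;> linarith)
  obtain ⟨x₂, hx₂, hTx₂⟩ := himg (show t - (t - s) / 4 ∈ Ioo s t by constructor <;> linarith)
  have hne : (S.cyl w).Nonempty := ⟨x₁, hx₁⟩
  have hq := S.weight_pos hne
  have hq1 := S.weight_le_one w
  have hK := S.K_pos
  have hK1 := S.one_le_K
  obtain ⟨x₀, hx₀, hfix⟩ := exists_abs_sub_le (S.ordConnected_cyl w) hne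
    (bddBelow_Ioo.mono hsub) (bddAbove_Ioo.mono hsub) (S.continuousOn_iterate w)
    (hsub.trans himg) (half_pos hρ)
  have h12 := S.weight_mul_le hx₁ hx₂
  rw [hTx₁, hTx₂, abs_sub_comm, show t - (t - s) / 4 - (s + (t - s) / 4) = (t - s) / 2 by ring,
    abs_of_pos (by linarith)] at h12
  set d := S.weight w / (4 * S.K) * min (t - s) ρ with hd
  have hmin : 0 < min (t - s) ρ := lt_min (sub_pos.2 hst) hρ
  have hd0 : 0 < d := by positivity
  have hdρ : d ≤ S.weight w / (4 * S.K) * ρ := by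
    rw [hd]; gcongr; exact min_le_right _ _
  have hdst : d ≤ S.weight w / (4 * S.K) * (t - s) := by
    rw [hd]; gcongr; exact min_le_left _ _
  obtain ⟨x₃, hx₃, hx₃d⟩ : ∃ x ∈ S.cyl w, d ≤ |x - x₀| := by
    by_contra! hcon
    have h3 := hcon x₁ hx₁
    have h4 := hcon x₂ hx₂
    have h5 : |x₁ - x₂| < 2 * d := by
      rw [abs_lt] at h3 h4 ⊢
      constructor <;> linarith
    have h6 : S.K * |x₁ - x₂| < S.K * (2 * (S.weight w / (4 * S.K) * (t - s))) := by
      gcongr; linarith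
    have h7 : S.K * (2 * (S.weight w / (4 * S.K) * (t - s))) = S.weight w * ((t - s) / 2) := by
      field_simp; ring
    linarith
  obtain ⟨y, hy, hyd⟩ : ∃ y ∈ S.cyl w, |x₀ - y| = d / 2 := by
    rcases le_total x₀ x₃ with h | h
    · rw [abs_of_nonneg (sub_nonneg.2 h)] at hx₃d
      refine ⟨x₀ + d / 2, (S.ordConnected_cyl w).out hx₀ hx₃ ⟨by linarith, by linarith⟩, ?_⟩
      rw [abs_sub_comm, add_sub_cancel_left, abs_of_pos (by positivity)]
    · rw [abs_of_nonpos (sub_nonpos.2 h)] at hx₃d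
      refine ⟨x₀ - d / 2, (S.ordConnected_cyl w).out hx₃ hx₀ ⟨by linarith, by linarith⟩, ?_⟩
      rw [sub_sub_cancel, abs_of_pos (by positivity)]
  have hX : S.cyl w ∩ Ioo (x₀ - d) (x₀ + d) ⊆ S.cyl w ∩ S.near w.length ρ := by
    rintro x ⟨hx, hxd⟩
    refine ⟨hx, ?_⟩
    have hxd' : |x - x₀| < S.weight w / (4 * S.K) * ρ := by
      refine lt_of_lt_of_le (abs_lt.2 ⟨?_, ?_⟩) hdρ <;> linarith [hxd.1, hxd.2]
    have h1 := S.weight_mul_le hx hx₀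
    rw [mul_comm, ← le_div_iff₀ hq] at h1
    have h2 : S.K * |x - x₀| / S.weight w < ρ / 4 := by
      rw [div_lt_iff₀ hq]
      calc _ < S.K * (S.weight w / (4 * S.K) * ρ) := by gcongr
        _ = _ := by field_simp
    have h3 : |x - x₀| < ρ / 4 := by
      refine hxd'.trans_le ?_
      rw [div_mul_eq_mul_div, div_le_iff₀ (by positivity)]
      nlinarith
    change |_| < ρ
    have e : S.T^[w.length] x - x =
      (S.T^[w.length] x - S.T^[w.length] x₀) + (S.T^[w.length] x₀ - x₀) - (x - x₀) := by ring
    rw [e]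
    have h4 := abs_sub ((S.T^[w.length] x - S.T^[w.length] x₀) + (S.T^[w.length] x₀ - x₀)) (x - x₀)
    have h5 := abs_add_le (S.T^[w.length] x - S.T^[w.length] x₀) (S.T^[w.length] x₀ - x₀)
    linarith
  have hfin : volume (S.cyl w ∩ S.near w.length ρ) ≠ ⊤ :=
    measure_ne_top_of_subset inter_subset_left (S.volume_cyl_ne_top w)
  have hyabs := abs_le.1 hyd.le
  calc _ = d / 2 := by rw [hd]; field_simp; ring
    _ = |x₀ - y| := hyd.symm
    _ ≤ volume.real (S.cyl w ∩ Ioo (x₀ - d) (x₀ + d)) :=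
      abs_sub_le_volume ((S.ordConnected_cyl w).inter ordConnected_Ioo)
        (measure_ne_top_of_subset hX hfin) ⟨hx₀, by constructor <;> linarith⟩
        ⟨hy, by constructor <;> linarith⟩
    _ ≤ _ := measureReal_mono hX hfin

/-- For large times, the cylinders meeting an interval `A` in points that return to `A` have total
weight at least a fixed multiple of the length of `A`. -/
lemma eventually_le_sum_return [IsFiniteMeasure μ] {c : ℝ} (hc : 1 ≤ c) (hT : Measurable S.T)
    (hle : ∀ X, MeasurableSet X → X ⊆ Icc 0 1 → μ.real X ≤ c * volume.real X)
    (hge : ∀ X, MeasurableSet X → X ⊆ Icc 0 1 → volume.real X ≤ c * μ.real X)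
    (hcov : ∀ n, ∀ᵐ x ∂μ, ∃ w ∈ words ι n, x ∈ S.cyl w) {s t : ℝ} (hst : s < t)
    (hsub : Ioo s t ⊆ Ioo 0 1)
    (hmix : Tendsto (fun n => μ.real (Ioo s t ∩ S.T^[n] ⁻¹' Ioo s t)) atTop
      (𝓝 (μ.real (Ioo s t) * μ.real (Ioo s t)))) :
    ∀ᶠ n in atTop, (2 * c ^ 3 * S.K)⁻¹ * (t - s) ≤
      ∑ w ∈ words ι n with (S.cyl w ∩ (Ioo s t ∩ S.T^[n] ⁻¹' Ioo s t)).Nonempty, S.weight w := by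
  have hK := S.K_pos
  have hc0 : 0 < c := by linarith
  have hvol : volume.real (Ioo s t) = t - s := Real.volume_real_Ioo_of_le hst.le
  have hℓ : 0 < t - s := sub_pos.2 hst
  have hA := hge _ measurableSet_Ioo (hsub.trans Ioo_subset_Icc_self)
  rw [hvol] at hA
  have hA' : (t - s) / c ≤ μ.real (Ioo s t) := by rw [div_le_iff₀ hc0]; linarith
  have hApos : 0 < μ.real (Ioo s t) := lt_of_lt_of_le (by positivity) hA'
  filter_upwards [hmix.eventually (lt_mem_nhds (half_lt_self (mul_pos hApos hApos)))] with n hn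
  have hsum : μ.real (Ioo s t ∩ S.T^[n] ⁻¹' Ioo s t) ≤ c * S.K * (t - s) *
      ∑ w ∈ words ι n with (S.cyl w ∩ (Ioo s t ∩ S.T^[n] ⁻¹' Ioo s t)).Nonempty, S.weight w := by
    refine (S.measureReal_le_sum (hcov n) _).trans ?_
    rw [Finset.mul_sum, Finset.sum_filter]
    refine Finset.sum_le_sum fun w hw => ?_
    have hlen := length_of_mem_words hw
    split_ifs with h
    · calc _ ≤ c * volume.real (S.cyl w ∩ (Ioo s t ∩ S.T^[n] ⁻¹' Ioo s t)) :=
            hle _ ((S.measurableSet_cyl w).inter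
              (measurableSet_Ioo.inter (hT.iterate n measurableSet_Ioo)))
              fun x hx => Ioo_subset_Icc_self (S.cyl_subset w hx.1)
        _ ≤ c * (S.K * S.weight w * (t - s)) := by
          have hw0 := S.weight_nonneg w
          gcongr
          refine volume_real_le (by positivity) fun x hx y hy => ?_
          refine (S.abs_sub_le_weight hx.1 hy.1).trans ?_
          rw [hlen]
          gcongr
          have hx' : S.T^[n] x ∈ Ioo s t := hx.2.2
          have hy' : S.T^[n] y ∈ Ioo s t := hy.2.2
          exact abs_le.2 ⟨by linarith [hx'.1, hy'.2], by linarith [hx'.2, hy'.1]⟩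
        _ = _ := by ring
    · rw [not_nonempty_iff_eq_empty.1 h]
      simp
  set W := ∑ w ∈ words ι n with (S.cyl w ∩ (Ioo s t ∩ S.T^[n] ⁻¹' Ioo s t)).Nonempty, S.weight w
  have h1 : (t - s) / c * ((t - s) / c) / 2 ≤ c * S.K * (t - s) * W := by
    refine le_trans ?_ (hn.le.trans hsum)
    gcongr
  have h2 : (t - s) / c * ((t - s) / c) / 2 =
      c * S.K * (t - s) * ((2 * c ^ 3 * S.K)⁻¹ * (t - s)) := by
    field_simp
  rw [h2] at h1
  exact le_of_mul_le_mul_left h1 (by positivity)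

lemma exists_le_measure_near [IsFiniteMeasure μ] {c C θ : ℝ} (hc : 1 ≤ c) (hT : Measurable S.T)
    (hle : ∀ X, MeasurableSet X → X ⊆ Icc 0 1 → μ.real X ≤ c * volume.real X)
    (hge : ∀ X, MeasurableSet X → X ⊆ Icc 0 1 → volume.real X ≤ c * μ.real X)
    (hcov : ∀ n, ∀ᵐ x ∂μ, ∃ w ∈ words ι n, x ∈ S.cyl w)
    (hmix : ∀ A, MeasurableSet A → Tendsto (fun n => μ.real (A ∩ S.T^[n] ⁻¹' A)) atTop
      (𝓝 (μ.real A * μ.real A)))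
    (hC : 0 < C) (hθ0 : 0 < θ) (hθ1 : θ < 1)
    (hgrow : ∀ (n : ℕ) (B : Set ℝ), B.OrdConnected → BddBelow B → BddAbove B →
      S.hitSum n B ≤ C * (volume.real B + θ ^ n)) :
    ∃ η > 0, ∃ a > 0, ∀ᶠ n in atTop, ∀ ρ, 0 ≤ ρ →
      η * min a ρ ≤ μ.real (Icc 0 1 ∩ S.near n ρ) := by
  have hK := S.K_pos
  have hc0 : 0 < c := by linarith
  set κ := (2 * c ^ 3 * S.K)⁻¹ with hκ
  have hκ0 : 0 < κ := by positivity
  obtain ⟨p, -, hp⟩ := S.exists_inv_lam_pow_lt (ε := κ / (8 * C)) (by positivity)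
  obtain ⟨s, t, hst, hsub, hA⟩ := exists_Ioo_forall_subset_or_disjoint (words ι p)
    (fun v => S.T^[v.length] '' S.cyl v) S.ordConnected_image
  have hvol : volume.real (Ioo s t) = t - s := Real.volume_real_Ioo_of_le hst.le
  have hℓ : 0 < t - s := sub_pos.2 hst
  refine ⟨c⁻¹ * (8 * S.K)⁻¹ * (κ * (t - s) / 2), by positivity, t - s, hℓ, ?_⟩
  have hret := S.eventually_le_sum_return hc hT hle hge hcov hst hsub (hmix _ measurableSet_Ioo)
  have hlam0 := tendsto_pow_atTop_nhds_zero_of_lt_one S.inv_lam_pos.le S.inv_lam_lt_one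
  have hθlim := tendsto_pow_atTop_nhds_zero_of_lt_one hθ0.le hθ1
  have hev : ∀ᶠ n : ℕ in atTop, S.lam⁻¹ ^ n < κ * (t - s) / 16 ∧ θ ^ (n - p) < (t - s) / 2 ∧
      p ≤ n :=
    (hlam0.eventually (gt_mem_nhds (by positivity))).and
      (((hθlim.comp (tendsto_sub_atTop_nat p)).eventually (gt_mem_nhds (by positivity))).and
        (eventually_ge_atTop p))
  filter_upwards [hret, hev] with k hk ⟨hk1, hk2, hpk⟩ ρ hρ
  obtain ⟨n, rfl⟩ := Nat.exists_eq_add_of_le' hpk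
  rw [Nat.add_sub_cancel] at hk2
  have hsplit := S.sum_le_sum_full_add n p (B := Ioo s t) ordConnected_Ioo bddBelow_Ioo
    bddAbove_Ioo (Q := fun w => (S.cyl w ∩ (Ioo s t ∩ S.T^[n + p] ⁻¹' Ioo s t)).Nonempty)
    fun w hw => hw.mono (inter_subset_inter_right _ inter_subset_left)
  have hg := hgrow n (Ioo s t) ordConnected_Ioo bddBelow_Ioo bddAbove_Ioo
  rw [hvol] at hg
  have hnf : 2 * S.lam⁻¹ ^ p * S.hitSum n (Ioo s t) ≤
      2 * (κ / (8 * C)) * (C * ((t - s) + θ ^ n)) := by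
    have := S.hitSum_nonneg n (Ioo s t)
    gcongr
  rw [show 2 * (κ / (8 * C)) * (C * ((t - s) + θ ^ n)) = κ / 4 * ((t - s) + θ ^ n) by
    field_simp; ring] at hnf
  set G := (words ι (n + p)).filter fun w =>
    (S.cyl w ∩ (Ioo s t ∩ S.T^[n + p] ⁻¹' Ioo s t)).Nonempty ∧ S.IsFull n w ∧ S.cyl w ⊆ Ioo s t
    with hGdef
  have hG : κ * (t - s) / 2 ≤ ∑ w ∈ G, S.weight w := by
    nlinarith
  rcases hρ.eq_or_lt with rfl | hρ
  · rw [min_eq_right hℓ.le, mul_zero]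
    exact measureReal_nonneg
  have hmin : 0 < min (t - s) ρ := lt_min hℓ hρ
  have hgood : ∀ w ∈ G, c⁻¹ * (8 * S.K)⁻¹ * min (t - s) ρ * S.weight w ≤
      μ.real (S.cyl w ∩ S.near (n + p) ρ) := by
    intro w hw
    obtain ⟨hw, ⟨x, hxw, hxA, hxT⟩, hfull, hwsub⟩ := Finset.mem_filter.1 hw
    have hlen := length_of_mem_words hw
    have himg : Ioo s t ⊆ S.T^[w.length] '' S.cyl w := by
      obtain ⟨u, hu, v, hv, rfl⟩ := exists_append_of_mem_words hw
      rw [S.isFull_append hu] at hfull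
      have hu' := length_of_mem_words hu
      have hv' := length_of_mem_words hv
      rw [mem_cyl_append, hu'] at hxw
      have hxT' : S.T^[n + p] x ∈ Ioo s t := hxT
      rw [add_comm, Function.iterate_add_apply] at hxT'
      refine (hA v hv ⟨_, hxT', ?_⟩).trans ?_
      · rw [hv']
        exact ⟨_, hxw.2, rfl⟩
      · rintro _ ⟨y, hy, rfl⟩
        obtain ⟨z, hz, rfl⟩ := hfull hy
        refine ⟨z, (S.mem_cyl_append u v z).2 ⟨hz, by rwa [hu']⟩, ?_⟩
        rw [hlen, hv', add_comm n p, Function.iterate_add_apply]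
    have h1 := S.le_volume_near hst hwsub himg hρ
    rw [hlen] at h1
    have h2 := hge _ ((S.measurableSet_cyl w).inter (S.measurableSet_near hT (n + p) ρ))
      fun x hx => Ioo_subset_Icc_self (S.cyl_subset w hx.1)
    calc _ = c⁻¹ * (S.weight w / (8 * S.K) * min (t - s) ρ) := by ring
      _ ≤ c⁻¹ * (c * μ.real (S.cyl w ∩ S.near (n + p) ρ)) := by
        exact mul_le_mul_of_nonneg_left (h1.trans h2) (inv_nonneg.2 hc0.le)
      _ = _ := by field_simp
  calc _ = c⁻¹ * (8 * S.K)⁻¹ * min (t - s) ρ * (κ * (t - s) / 2) := by ring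
    _ ≤ c⁻¹ * (8 * S.K)⁻¹ * min (t - s) ρ * ∑ w ∈ G, S.weight w := by gcongr
    _ ≤ ∑ w ∈ G, μ.real (S.cyl w ∩ S.near (n + p) ρ) := by
      rw [Finset.mul_sum]
      exact Finset.sum_le_sum hgood
    _ = μ.real (⋃ w ∈ G, S.cyl w ∩ S.near (n + p) ρ) := by
      rw [measureReal_biUnion_finset]
      · intro v hv w hw hne
        refine Set.disjoint_left.2 fun x hxv hxw => hne ?_
        exact S.eq_of_mem_cyl (Finset.mem_filter.1 hv).1 (Finset.mem_filter.1 hw).1 hxv.1 hxw.1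
      · exact fun w _ => (S.measurableSet_cyl w).inter (S.measurableSet_near hT _ _)
    _ ≤ _ := measureReal_mono (iUnion₂_subset fun w _ => inter_subset_inter_left _
        ((S.cyl_subset w).trans Ioo_subset_Icc_self))

end Measure

end ExpandingSystem

section Branch

open Set

variable {g : ℝ → ℝ} {u v lam : ℝ}

lemma exists_abs_sub_eq_abs_derivWithin_mul (hg : ContDiffOn ℝ 2 g (Icc u v)) {x y : ℝ}
    (hx : x ∈ Icc u v) (hy : y ∈ Icc u v) :
    ∃ ξ ∈ uIcc x y, |g x - g y| = |derivWithin g (Icc u v) ξ| * |x - y| := by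
  wlog hxy : x < y generalizing x y
  · rcases (not_lt.1 hxy).eq_or_lt with rfl | hxy
    · exact ⟨y, left_mem_uIcc, by simp⟩
    · obtain ⟨ξ, hξ, h⟩ := this hy hx hxy
      exact ⟨ξ, by rwa [uIcc_comm], by rwa [abs_sub_comm, abs_sub_comm x]⟩
  obtain ⟨ξ, hξ, h⟩ := exists_deriv_eq_slope g hxy
    (hg.continuousOn.mono (Icc_subset_Icc hx.1 hy.2))
    ((hg.differentiableOn (by norm_num)).mono
      (Ioo_subset_Icc_self.trans (Icc_subset_Icc hx.1 hy.2)))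
  refine ⟨ξ, by rw [uIcc_of_le hxy.le]; exact Ioo_subset_Icc_self hξ, ?_⟩
  rw [derivWithin_of_mem_nhds (Icc_mem_nhds (hx.1.trans_lt hξ.1) (hξ.2.trans_le hy.2)), h, abs_div,
    abs_sub_comm x, div_mul_cancel₀ _ (abs_ne_zero.2 (sub_ne_zero.2 hxy.ne')), abs_sub_comm]

lemma exists_abs_derivWithin_sub_le (huv : u < v) (hg : ContDiffOn ℝ 2 g (Icc u v)) :
    ∃ M, 0 ≤ M ∧ ∀ x ∈ Icc u v, ∀ y ∈ Icc u v,
      |derivWithin g (Icc u v) x - derivWithin g (Icc u v) y| ≤ M * |x - y| := by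
  have h : ContDiffOn ℝ 1 (derivWithin g (Icc u v)) (Icc u v) :=
    hg.derivWithin (uniqueDiffOn_Icc huv) (by norm_num)
  obtain ⟨M, hM⟩ := h.exists_lipschitzOnWith one_ne_zero (convex_Icc u v) isCompact_Icc
  refine ⟨M, M.2, fun x hx y hy => ?_⟩
  simpa [Real.dist_eq] using hM.dist_le_mul x hx y hy

lemma lam_mul_abs_sub_le (hg : ContDiffOn ℝ 2 g (Icc u v))
    (hD : ∀ x ∈ Icc u v, lam ≤ |derivWithin g (Icc u v) x|) {x y : ℝ}
    (hx : x ∈ Icc u v) (hy : y ∈ Icc u v) : lam * |x - y| ≤ |g x - g y| := by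
  obtain ⟨ξ, hξ, h⟩ := exists_abs_sub_eq_abs_derivWithin_mul hg hx hy
  rw [h]
  exact mul_le_mul_of_nonneg_right (hD ξ (ordConnected_Icc.uIcc_subset hx hy hξ)) (abs_nonneg _)

lemma monotoneOn_or_antitoneOn_of_le_abs_derivWithin (huv : u < v) (hlam : 0 < lam)
    (hg : ContDiffOn ℝ 2 g (Icc u v))
    (hD : ∀ x ∈ Icc u v, lam ≤ |derivWithin g (Icc u v) x|) :
    MonotoneOn g (Icc u v) ∨ AntitoneOn g (Icc u v) := by
  have hinj : InjOn g (Icc u v) := fun x hx y hy hxy => by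
    have h := lam_mul_abs_sub_le hg hD hx hy
    rw [hxy, sub_self, abs_zero] at h
    exact sub_eq_zero.1 (abs_eq_zero.1 (le_antisymm (nonpos_of_mul_nonpos_right h hlam)
      (abs_nonneg _)))
  exact (hg.continuousOn.strictMonoOn_of_injOn_Icc' huv.le hinj).imp StrictMonoOn.monotoneOn
    StrictAntiOn.antitoneOn

lemma le_exp_mul_of_abs_sub_le {p q t : ℝ} (hq : 1 ≤ q) (ht : 0 ≤ t) (h : |p - q| ≤ t) :
    p ≤ Real.exp t * q := by
  have h1 := (abs_le.1 h).2
  have h2 := Real.add_one_le_exp t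
  nlinarith

lemma exp_neg_mul_le_and_le_exp_mul (hlam : 1 ≤ lam) (hg : ContDiffOn ℝ 2 g (Icc u v))
    (hD : ∀ x ∈ Icc u v, lam ≤ |derivWithin g (Icc u v) x|) {M : ℝ} (hM0 : 0 ≤ M)
    (hM : ∀ x ∈ Icc u v, ∀ y ∈ Icc u v,
      |derivWithin g (Icc u v) x - derivWithin g (Icc u v) y| ≤ M * |x - y|)
    {x y z δ : ℝ} (hx : x ∈ Icc u v) (hy : y ∈ Icc u v) (hz : z ∈ Icc u v)
    (hxz : |x - z| ≤ δ) (hyz : |y - z| ≤ δ) :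
    Real.exp (-(M * δ)) * |x - y| ≤ |derivWithin g (Icc u v) z|⁻¹ * |g x - g y| ∧
      |derivWithin g (Icc u v) z|⁻¹ * |g x - g y| ≤ Real.exp (M * δ) * |x - y| := by
  obtain ⟨ξ, hξ, h⟩ := exists_abs_sub_eq_abs_derivWithin_mul hg hx hy
  have hξ' := ordConnected_Icc.uIcc_subset hx hy hξ
  have hδ0 := (abs_nonneg _).trans hxz
  have hξz : |ξ - z| ≤ δ := by
    have : ξ ∈ Icc (z - δ) (z + δ) := ordConnected_Icc.uIcc_subset
      (mem_Icc_iff_abs_le.1 (by rwa [abs_sub_comm])) (mem_Icc_iff_abs_le.1 (by rwa [abs_sub_comm]))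
      hξ
    rw [abs_sub_comm]
    exact mem_Icc_iff_abs_le.2 this
  have hdiff : |(|derivWithin g (Icc u v) ξ| - |derivWithin g (Icc u v) z|)| ≤ M * δ :=
    (abs_abs_sub_abs_le _ _).trans ((hM ξ hξ' z hz).trans (by gcongr))
  have hz1 := hlam.trans (hD z hz)
  have h1 := le_exp_mul_of_abs_sub_le hz1 (by positivity) hdiff
  rw [abs_sub_comm] at hdiff
  have h2 := le_exp_mul_of_abs_sub_le (hlam.trans (hD ξ hξ')) (by positivity) hdiff
  have hz0 : 0 < |derivWithin g (Icc u v) z| := by linarith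
  rw [h, ← mul_assoc]
  refine ⟨mul_le_mul_of_nonneg_right ?_ (abs_nonneg _),
    mul_le_mul_of_nonneg_right ?_ (abs_nonneg _)⟩
  · rw [Real.exp_neg, le_inv_mul_iff₀ hz0, ← div_eq_mul_inv, div_le_iff₀ (Real.exp_pos _)]
    linarith
  · rw [inv_mul_le_iff₀ hz0]
    linarith

end Branch

lemma exists_mem_Ico_of_mem_Ico {N : ℕ} {a : ℕ → ℝ} {x : ℝ} (hx : x ∈ Set.Ico (a 0) (a N)) :
    ∃ i < N, x ∈ Set.Ico (a i) (a (i + 1)) := by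
  induction N with
  | zero => exact absurd hx.2 (not_lt.2 hx.1)
  | succ N ih =>
    by_cases h : x < a N
    · obtain ⟨i, hi, hxi⟩ := ih ⟨hx.1, h⟩
      exact ⟨i, hi.trans N.lt_succ_self, hxi⟩
    · exact ⟨N, N.lt_succ_self, not_lt.1 h, hx.2⟩

lemma IsPiecewiseC2ExpandingWith.exists_expandingSystem {T : ℝ → ℝ} {lam Lam : ℝ}
    (hT : IsPiecewiseC2ExpandingWith T lam Lam) :
    ∃ (N : ℕ) (S : ExpandingSystem (Fin N)), S.T = T ∧ S.lam = lam := by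
  obtain ⟨hlam, -, -, N, a, -, ha0, haN, ha, hbr⟩ := hT
  have hmono := strictMonoOn_Iic_of_lt_succ ha
  choose! g hg hTg hD using hbr
  choose! M hM0 hM using fun i hi => exists_abs_derivWithin_sub_le (ha i hi) (hg i hi)
  have hEq : ∀ i < N, Set.EqOn T (g i) (Set.Ioo (a i) (a (i + 1))) := fun i hi =>
    (hTg i hi).mono Set.Ioo_subset_Ico_self
  have hsum : ∀ i < N, M i ≤ ∑ j ∈ Finset.range N, M j := fun i hi =>
    Finset.single_le_sum (fun j hj => hM0 j (Finset.mem_range.1 hj)) (Finset.mem_range.2 hi)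
  refine ⟨N,
    { T := T
      P := fun i => Set.Ioo (a i) (a (i + 1))
      D := fun i x => |derivWithin (g i) (Set.Icc (a i) (a (i + 1))) x|
      lam := lam
      L := ∑ j ∈ Finset.range N, M j
      one_lt_lam := hlam
      L_nonneg := Finset.sum_nonneg fun j hj => hM0 j (Finset.mem_range.1 hj)
      isOpen_P := fun i => isOpen_Ioo
      ordConnected_P := fun i => Set.ordConnected_Ioo
      P_subset := fun i => ?_
      eq_of_mem_P := ?_
      countable_compl := ?_
      lam_le_D := fun i x hx => (hD i i.2 x (Set.Ioo_subset_Icc_self hx)).1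
      continuousOn_T := fun i =>
        ((hg i i.2).continuousOn.mono Set.Ioo_subset_Icc_self).congr (hEq i i.2)
      monotoneOn_or_antitoneOn := fun i => ?_
      expand := fun i x hx y hy => ?_
      distortion := fun i x hx y hy z hz δ _ hxz hyz => ?_ }, rfl, rfl⟩
  · refine Set.Ioo_subset_Ioo ?_ ?_
    · rw [← ha0]
      exact hmono.monotoneOn (Nat.zero_le N) i.2.le (Nat.zero_le _)
    · rw [← haN]
      exact hmono.monotoneOn i.2 Set.self_mem_Iic i.2
  · intro i j x hi hj
    by_contra hne
    wlog hij : i < j generalizing i j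
    · exact this j i hj hi (Ne.symm hne) (lt_of_le_of_ne (not_lt.1 hij) (Ne.symm hne))
    have : a (i + 1) ≤ a j := hmono.monotoneOn i.2 j.2.le hij
    linarith [hi.2, hj.1]
  · refine ((Finset.range (N + 1)).image a).countable_toSet.mono ?_
    rintro x ⟨hx, hxP⟩
    simp only [Set.mem_iUnion, not_exists] at hxP
    rw [Finset.mem_coe, Finset.mem_image]
    rcases hx.2.eq_or_lt with rfl | hx1
    · exact ⟨N, by simp, haN⟩
    · obtain ⟨i, hi, hxi⟩ := exists_mem_Ico_of_mem_Ico (a := a) (N := N) (x := x)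
        ⟨ha0.trans_le hx.1, hx1.trans_eq haN.symm⟩
      refine ⟨i, Finset.mem_range.2 (by omega), ?_⟩
      by_contra hne
      exact hxP ⟨i, hi⟩ ⟨lt_of_le_of_ne hxi.1 hne, hxi.2⟩
  · exact (monotoneOn_or_antitoneOn_of_le_abs_derivWithin (ha i i.2) (by linarith) (hg i i.2)
      fun x hx => (hD i i.2 x hx).1).imp
      (fun h => (h.mono Set.Ioo_subset_Icc_self).congr (hEq i i.2).symm)
      fun h => (h.mono Set.Ioo_subset_Icc_self).congr (hEq i i.2).symm
  · rw [hEq i i.2 hx, hEq i i.2 hy]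
    exact lam_mul_abs_sub_le (hg i i.2) (fun x hx => (hD i i.2 x hx).1)
      (Set.Ioo_subset_Icc_self hx) (Set.Ioo_subset_Icc_self hy)
  · rw [hEq i i.2 hx, hEq i i.2 hy]
    refine exp_neg_mul_le_and_le_exp_mul hlam.le (hg i i.2) (fun x hx => (hD i i.2 x hx).1)
      (Finset.sum_nonneg fun j hj => hM0 j (Finset.mem_range.1 hj))
      (fun x hx y hy => (hM i i.2 x hx y hy).trans ?_)
      (Set.Ioo_subset_Icc_self hx) (Set.Ioo_subset_Icc_self hy) (Set.Ioo_subset_Icc_self hz)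
      hxz hyz
    exact mul_le_mul_of_nonneg_right (hsum i i.2) (abs_nonneg _)

section Density

open Set

variable {μ : Measure ℝ} {h : ℝ → ℝ} {c : ℝ}

lemma withDensity_apply_of_subset_Icc
    (hdens : μ = (volume.restrict (Icc 0 1)).withDensity (fun x => ENNReal.ofReal (h x)))
    {X : Set ℝ} (hX : MeasurableSet X) (hX01 : X ⊆ Icc 0 1) :
    μ X = ∫⁻ x in X, ENNReal.ofReal (h x) := by
  rw [hdens, withDensity_apply _ hX, Measure.restrict_restrict hX, inter_eq_left.2 hX01]

lemma measureReal_le_mul_volume_of_density_le (hc : 0 ≤ c)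
    (hdens : μ = (volume.restrict (Icc 0 1)).withDensity (fun x => ENNReal.ofReal (h x)))
    (hh : ∀ x ∈ Icc (0 : ℝ) 1, h x ≤ c) {X : Set ℝ} (hX : MeasurableSet X)
    (hX01 : X ⊆ Icc 0 1) : μ.real X ≤ c * volume.real X := by
  have hfin : volume X ≠ ⊤ := measure_ne_top_of_subset hX01 (by simp)
  have hle : μ X ≤ ENNReal.ofReal c * volume X := by
    rw [withDensity_apply_of_subset_Icc hdens hX hX01, ← setLIntegral_const]
    exact setLIntegral_mono' hX fun x hx => ENNReal.ofReal_le_ofReal (hh x (hX01 hx))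
  have := ENNReal.toReal_mono (ENNReal.mul_ne_top ENNReal.ofReal_ne_top hfin) hle
  rwa [ENNReal.toReal_mul, ENNReal.toReal_ofReal hc] at this

lemma volume_le_mul_measureReal_of_le_density [IsFiniteMeasure μ] (hc : 0 < c)
    (hdens : μ = (volume.restrict (Icc 0 1)).withDensity (fun x => ENNReal.ofReal (h x)))
    (hh : ∀ x ∈ Icc (0 : ℝ) 1, c⁻¹ ≤ h x) {X : Set ℝ} (hX : MeasurableSet X)
    (hX01 : X ⊆ Icc 0 1) : volume.real X ≤ c * μ.real X := by
  have hle : ENNReal.ofReal c⁻¹ * volume X ≤ μ X := by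
    rw [withDensity_apply_of_subset_Icc hdens hX hX01, ← setLIntegral_const]
    exact setLIntegral_mono' hX fun x hx => ENNReal.ofReal_le_ofReal (hh x (hX01 hx))
  have := ENNReal.toReal_mono (measure_ne_top μ X) hle
  rwa [ENNReal.toReal_mul, ENNReal.toReal_ofReal (inv_nonneg.2 hc.le), inv_mul_le_iff₀ hc] at this

end Density

lemma exists_pow_le_mul_of_rpow_neg_le {θ γ K : ℝ} (hθ0 : 0 < θ) (hθ1 : θ < 1) {r : ℕ → ℝ}
    (hr : ∀ n, 0 ≤ r n) (hO : ∀ n : ℕ, 1 ≤ n → (n : ℝ) ^ (-γ) ≤ K * r n) :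
    ∃ C, 0 ≤ C ∧ ∀ n : ℕ, 1 ≤ n → θ ^ n ≤ C * r n := by
  obtain ⟨k, hk⟩ := exists_nat_ge γ
  obtain ⟨M, hM⟩ := (tendsto_pow_const_mul_const_pow_of_lt_one k hθ0.le hθ1).bddAbove_range
  have hM0 : 0 ≤ M := le_trans (by positivity) (hM ⟨1, rfl⟩)
  refine ⟨M * |K|, by positivity, fun n hn => ?_⟩
  have hn1 : (1 : ℝ) ≤ n := by exact_mod_cast hn
  have hn0 : (0 : ℝ) < n := by linarith
  have h1 : (n : ℝ) ^ k * θ ^ n ≤ M := hM ⟨n, rfl⟩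
  have h2 : ((n : ℝ) ^ k)⁻¹ ≤ |K| * r n := by
    calc ((n : ℝ) ^ k)⁻¹ = (n : ℝ) ^ (-(k : ℝ)) := by
          rw [Real.rpow_neg hn0.le, Real.rpow_natCast]
      _ ≤ (n : ℝ) ^ (-γ) := Real.rpow_le_rpow_of_exponent_le hn1 (by linarith)
      _ ≤ K * r n := hO n hn
      _ ≤ |K| * r n := mul_le_mul_of_nonneg_right (le_abs_self K) (hr n)
  calc θ ^ n = (n : ℝ) ^ k * θ ^ n * ((n : ℝ) ^ k)⁻¹ := by field_simp
    _ ≤ M * (|K| * r n) := mul_le_mul h1 h2 (by positivity) hM0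
    _ = _ := by ring

/-- The passage from a quasi-independence estimate in terms of the radii `r n`, together with an
eventual lower bound on `e n`, to one in terms of the `e n` themselves. -/
lemma exists_le_mul_add_of_eventually_le {e r : ℕ → ℝ} {f : ℕ → ℕ → ℝ} {A B q θ η a : ℝ}
    (hr : ∀ n, 0 ≤ r n) (he : ∀ n, 0 ≤ e n) (hq : 0 ≤ q) (hθ0 : 0 ≤ θ)
    (hA : 0 ≤ A) (hB : 0 ≤ B) (hη : 0 < η) (ha : 0 < a) (hf₁ : ∀ n m, f n m ≤ e n)
    (hf₂ : ∀ n m, f n m ≤ e (n + m))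
    (hθ : ∀ n, 1 ≤ n → θ ^ n ≤ A * r n)
    (hf : ∀ n m, n + m ≠ 0 → f n m ≤ B * r (n + m) * (r n + q ^ m + θ ^ n))
    (hlow : ∀ᶠ n in Filter.atTop, η * min a (r n) ≤ e n) :
    ∃ C > 0, ∀ m n, f n m ≤ C * e (n + m) * (e n + q ^ m) := by
  obtain ⟨N, hN⟩ := Filter.eventually_atTop.1 (hlow.and (Filter.eventually_ge_atTop 1))
  have hηa : 0 < (η * a)⁻¹ := by positivity
  set S := ∑ k ∈ Finset.range N, (e k)⁻¹ with hS
  have hS0 : 0 ≤ S := Finset.sum_nonneg fun k _ => inv_nonneg.2 (he k)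
  set R := B * η⁻¹ * ((1 + A) * η⁻¹ + 1) with hR
  have hR0 : 0 ≤ R := by positivity
  refine ⟨S + (η * a)⁻¹ + R, by positivity, fun m n => ?_⟩
  have hen := he n
  have henm := he (n + m)
  have hqm : 0 ≤ q ^ m := pow_nonneg hq m
  have of_le : ∀ C, 0 ≤ C → C ≤ S + (η * a)⁻¹ + R → f n m ≤ C * e (n + m) * (e n + q ^ m) →
      f n m ≤ (S + (η * a)⁻¹ + R) * e (n + m) * (e n + q ^ m) := fun C _ h1 h2 =>
    h2.trans (by gcongr)
  rcases lt_or_ge n N with hn | hn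
  · refine of_le S hS0 (by linarith) ?_
    rcases hen.eq_or_lt with h0 | h0
    · exact (hf₁ n m).trans (by rw [← h0]; positivity)
    · calc f n m ≤ e (n + m) := hf₂ n m
        _ = (e n)⁻¹ * e (n + m) * (e n + 0) := by field_simp; ring
        _ ≤ S * e (n + m) * (e n + q ^ m) := by
          gcongr
          exact Finset.single_le_sum (f := fun k => (e k)⁻¹) (fun k _ => inv_nonneg.2 (he k))
            (Finset.mem_range.2 hn)
  obtain ⟨hn1, hn2⟩ := hN n hn
  obtain ⟨hm1, -⟩ := hN (n + m) (by omega)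
  rcases le_total a (r (n + m)) with h1 | h1
  · refine of_le _ hηa.le (by linarith) ?_
    rw [min_eq_left h1] at hm1
    calc f n m ≤ e n := hf₁ n m
      _ = (η * a)⁻¹ * (η * a) * (e n + 0) := by field_simp; ring
      _ ≤ _ := by gcongr
  rcases le_total a (r n) with h2 | h2
  · refine of_le _ hηa.le (by linarith) ?_
    rw [min_eq_left h2] at hn1
    calc f n m ≤ e (n + m) := hf₂ n m
      _ = (η * a)⁻¹ * e (n + m) * (η * a + 0) := by field_simp; ring
      _ ≤ _ := by gcongr
  refine of_le R hR0 (by linarith) ?_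
  rw [min_eq_right h1, ← le_inv_mul_iff₀ hη] at hm1
  rw [min_eq_right h2, ← le_inv_mul_iff₀ hη] at hn1
  have hrn := hr n
  have hrnm := hr (n + m)
  calc f n m ≤ B * r (n + m) * (r n + q ^ m + θ ^ n) := hf n m (by omega)
    _ ≤ B * (η⁻¹ * e (n + m)) * ((1 + A) * (η⁻¹ * e n) + q ^ m) := by
      refine mul_le_mul (by gcongr) ?_ ?_ (by positivity)
      · have := hθ n hn2
        have : (1 + A) * r n ≤ (1 + A) * (η⁻¹ * e n) := by gcongr
        linarith
      · positivity
    _ ≤ B * (η⁻¹ * e (n + m)) * (((1 + A) * η⁻¹ + 1) * (e n + q ^ m)) := by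
      gcongr
      have : 0 ≤ (1 + A) * η⁻¹ * q ^ m := by positivity
      linarith
    _ = _ := by rw [hR]; ring

theorem stmt13 (T : ℝ → ℝ) (lam Lam : ℝ) (hT : IsPiecewiseC2ExpandingWith T lam Lam)
    (hLI : LargeImageProperty T)
    (μ : Measure ℝ) [IsProbabilityMeasure μ] (hmix : Mixing T μ) (hErg : Ergodic T μ)
    (h : ℝ → ℝ) (c : ℝ) (hc : 1 ≤ c)
    (hdens : μ = (volume.restrict (Set.Icc 0 1)).withDensity (fun x => ENNReal.ofReal (h x)))
    (hBV : BoundedVariationOn h (Set.Icc 0 1))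
    (hbound : ∀ x ∈ Set.Icc (0:ℝ) 1, c⁻¹ ≤ h x ∧ h x ≤ c)
    (r : ℕ → ℝ) (hr : ∀ n, 0 ≤ r n)
    (γ : ℝ) (hγ : 0 < γ)
    (hO : ∃ K > (0:ℝ), ∀ n : ℕ, 1 ≤ n → (n : ℝ) ^ (-γ) ≤ K * r n) :
    ∃ C > (0:ℝ), ∀ m n : ℕ,
      (μ (En T r n ∩ En T r (n + m))).toReal ≤
        C * (μ (En T r (n + m))).toReal * ((μ (En T r n)).toReal + lam ^ (-(m : ℝ))) := by
  obtain ⟨N, S, rfl, rfl⟩ := hT.exists_expandingSystem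
  obtain ⟨K, -, hO⟩ := hO
  have hc0 : 0 < c := by linarith
  have hpres : MeasurePreserving S.T μ μ := hErg.toMeasurePreserving
  have hmeas := hpres.measurable
  have hle : ∀ X, MeasurableSet X → X ⊆ Set.Icc 0 1 → μ.real X ≤ c * volume.real X :=
    fun X hX hX01 => measureReal_le_mul_volume_of_density_le hc0.le hdens
      (fun x hx => (hbound x hx).2) hX hX01
  have hge : ∀ X, MeasurableSet X → X ⊆ Set.Icc 0 1 → volume.real X ≤ c * μ.real X :=
    fun X hX hX01 => volume_le_mul_measureReal_of_le_density hc0 hdens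
      (fun x hx => (hbound x hx).1) hX hX01
  have hac' : μ ≪ volume.restrict (Set.Icc 0 1) := by
    rw [hdens]
    exact withDensity_absolutelyContinuous _ _
  have hcov := S.ae_exists_mem_cyl hpres (hac'.trans Measure.restrict_le_self.absolutelyContinuous)
    (hac'.ae_le (ae_restrict_mem measurableSet_Icc))
  have hmix' : ∀ A, MeasurableSet A → Filter.Tendsto (fun n => μ.real (A ∩ S.T^[n] ⁻¹' A))
      Filter.atTop (nhds (μ.real A * μ.real A)) := fun A hA => by
    have := (ENNReal.tendsto_toReal (ENNReal.mul_ne_top (measure_ne_top μ A)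
      (measure_ne_top μ A))).comp (hmix A A hA hA)
    rwa [ENNReal.toReal_mul] at this
  obtain ⟨D, θ, hD, hθ0, hθ1, -, hgrow⟩ := S.exists_hitSum_le
  obtain ⟨η, hη, a, ha, hlow⟩ :=
    S.exists_le_measure_near hc hmeas hle hge hcov hmix' hD hθ0 hθ1 hgrow
  obtain ⟨A, hA, hθr⟩ := exists_pow_le_mul_of_rpow_neg_le hθ0 hθ1 hr hO
  have hlam1 : 0 < 1 - S.lam⁻¹ := sub_pos.2 S.inv_lam_lt_one
  have hK := S.K_pos
  have hrpow : ∀ m : ℕ, S.lam ^ (-(m : ℝ)) = S.lam⁻¹ ^ m := fun m => by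
    rw [Real.rpow_neg (by linarith [S.one_lt_lam]), Real.rpow_natCast, inv_pow]
  simp only [hrpow]
  refine exists_le_mul_add_of_eventually_le (e := fun n => μ.real (En S.T r n))
    (f := fun n m => μ.real (En S.T r n ∩ En S.T r (n + m))) (r := r) (θ := θ)
    (B := c * (2 * S.K / (1 - S.lam⁻¹)) * (4 * D ^ 2)) hr (fun n => measureReal_nonneg)
    S.inv_lam_pos.le hθ0.le hA (by positivity) hη ha
    (fun n m => measureReal_mono Set.inter_subset_left)
    (fun n m => measureReal_mono Set.inter_subset_right) hθr (fun n m hnm => ?_)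
    (hlow.mono fun n hn => hn (r n) (hr n))
  have hsub : En S.T r n ∩ En S.T r (n + m) ⊆ S.near n (r n) ∩ S.near (n + m) (r (n + m)) :=
    fun x hx => ⟨hx.1.2, hx.2.2⟩
  exact (measureReal_mono hsub).trans
    (S.measure_return_le hc0.le hmeas hle hcov hD hθ0 hθ1 hgrow hnm (hr n) (hr (n + m)))
end

section
/- Let B be a d×d integer matrix none of whose eigenvalues is a root of unity, let m, n be positive integers, and let p = gcd(m,n). Then for k, l ∈ ℤ^d, the equation (B^m − I)k = (B^n − I)l holds if and only if there exists j ∈ ℤ^d such that k = (I + B^p + B^{2p} + … + B^{n−p})·j and l = (I + B^p + B^{2p} + … + B^{m−p})·j. -/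
theorem isCoprime_geom_sum {R : Type*} [CommRing R] (x : R) {a b : ℕ} (h : a.Coprime b) :
    IsCoprime (∑ i ∈ Finset.range a, x ^ i) (∑ i ∈ Finset.range b, x ^ i) := by
  induction a, b using Nat.gcd.induction with
  | H0 b =>
    obtain rfl : b = 1 := by simpa using h
    simpa using isCoprime_one_right
  | H1 a b _ ih =>
    have hr : (b % a).Coprime a := by
      rwa [Nat.Coprime, ← Nat.gcd_rec]
    have hd : (∑ i ∈ Finset.range a, x ^ i) ∣ ∑ i ∈ Finset.range (a * (b / a)), x ^ i := by
      generalize b / a = q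
      induction q with
      | zero => simp
      | succ q hq =>
        rw [Nat.mul_succ, Finset.sum_range_add]
        refine dvd_add hq ?_
        simp_rw [pow_add, ← Finset.mul_sum]
        exact dvd_mul_left _ _
    obtain ⟨c, hc⟩ := hd
    have hb : ∑ i ∈ Finset.range b, x ^ i = ∑ i ∈ Finset.range (b % a), x ^ i +
        (∑ i ∈ Finset.range a, x ^ i) * (x ^ (b % a) * c) := by
      conv_lhs => rw [← Nat.mod_add_div b a, Finset.sum_range_add]
      simp_rw [pow_add, ← Finset.mul_sum, hc]
      ring
    rw [hb]
    exact (ih hr).symm.add_mul_left_right _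

theorem det_pow_sub_one_ne_zero {ι : Type*} [Fintype ι] [DecidableEq ι] (B : Matrix ι ι ℤ)
    {p : ℕ} (hp : 0 < p)
    (hB : ∀ z : ℂ, (Matrix.charpoly (B.map (Int.cast : ℤ → ℂ))).IsRoot z → z ^ p ≠ 1) :
    (B ^ p - 1).det ≠ 0 := by
  intro h
  set M := B.map (Int.cast : ℤ → ℂ) with hM
  have hdet : (M ^ p - 1).det = 0 := by
    have h' := congrArg (Int.castRingHom ℂ) h
    rw [RingHom.map_det, map_sub, map_pow, map_one, map_zero] at h'
    exact h'
  have h1 : (1 : ℂ) ∈ spectrum ℂ (M ^ p) := by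
    rw [Matrix.mem_spectrum_iff_isRoot_charpoly, Polynomial.IsRoot, Matrix.eval_charpoly,
      ← neg_sub, Matrix.det_neg]
    simp [hdet]
  rw [spectrum.map_pow_of_pos M hp] at h1
  obtain ⟨z, hz, hz1⟩ := h1
  exact hB z (Matrix.mem_spectrum_iff_isRoot_charpoly.mp hz) hz1

theorem geom_sum_mulVec_eq_iff {ι R : Type*} [Fintype ι] [DecidableEq ι] [CommRing R]
    (C : Matrix ι ι R) {a b : ℕ} (h : a.Coprime b) (k l : ι → R) :
    (∑ i ∈ Finset.range b, C ^ i).mulVec k = (∑ i ∈ Finset.range a, C ^ i).mulVec l ↔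
      ∃ j : ι → R, k = (∑ i ∈ Finset.range a, C ^ i).mulVec j ∧
        l = (∑ i ∈ Finset.range b, C ^ i).mulVec j := by
  have hS (c : ℕ) : ∑ i ∈ Finset.range c, C ^ i =
      Polynomial.aeval C (∑ i ∈ Finset.range c, (Polynomial.X : Polynomial R) ^ i) := by
    simp
  obtain ⟨u, v, huv⟩ := isCoprime_geom_sum (Polynomial.X : Polynomial R) h
  rw [hS, hS]
  generalize ∑ i ∈ Finset.range a, (Polynomial.X : Polynomial R) ^ i = f at *
  generalize ∑ i ∈ Finset.range b, (Polynomial.X : Polynomial R) ^ i = g at *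
  have hmul (r s : Polynomial R) (w : ι → R) : (Polynomial.aeval C r).mulVec
      ((Polynomial.aeval C s).mulVec w) = (Polynomial.aeval C (r * s)).mulVec w := by
    simp
  have hone (w : ι → R) :
      w = (Polynomial.aeval C (u * f)).mulVec w + (Polynomial.aeval C (v * g)).mulVec w := by
    rw [← Matrix.add_mulVec, ← map_add, huv, map_one, Matrix.one_mulVec]
  constructor
  · intro hkl
    refine ⟨(Polynomial.aeval C u).mulVec k + (Polynomial.aeval C v).mulVec l, ?_, ?_⟩
    · rw [Matrix.mulVec_add, hmul, hmul, mul_comm f v, ← hmul v, ← hkl, hmul, mul_comm f u]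
      exact hone k
    · rw [Matrix.mulVec_add, hmul, hmul, mul_comm g u, ← hmul u, hkl, hmul, mul_comm g v]
      exact hone l
  · rintro ⟨j, rfl, rfl⟩
    rw [hmul, hmul, mul_comm]

theorem stmt15 (d : ℕ) (B : Matrix (Fin d) (Fin d) ℤ)
    (hB : ∀ z : ℂ, (Matrix.charpoly (B.map (Int.cast : ℤ → ℂ))).IsRoot z →
      ∀ k : ℕ, k ≠ 0 → z ^ k ≠ 1)
    (m n : ℕ) (hm : 0 < m) (hn : 0 < n) (p : ℕ) (hp : p = Nat.gcd m n)
    (k l : Fin d → ℤ) :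
    (B ^ m - 1).mulVec k = (B ^ n - 1).mulVec l ↔
      ∃ j : Fin d → ℤ,
        k = (∑ i ∈ Finset.range (n / p), B ^ (i * p)).mulVec j ∧
        l = (∑ i ∈ Finset.range (m / p), B ^ (i * p)).mulVec j := by
  have hp0 : 0 < p := hp ▸ Nat.gcd_pos_of_pos_left n hm
  have hco : (n / p).Coprime (m / p) := by
    subst hp
    exact (Nat.coprime_div_gcd_div_gcd hp0).symm
  have hinj : Function.Injective (B ^ p - 1).mulVec := by
    refine Matrix.mulVec_injective_of_det_ne_zero ?_
    exact det_pow_sub_one_ne_zero B hp0 fun z hz => hB z hz p hp0.ne'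
  have hfac (c : ℕ) (hc : p ∣ c) :
      B ^ c - 1 = (B ^ p - 1) * ∑ i ∈ Finset.range (c / p), (B ^ p) ^ i := by
    rw [mul_geom_sum, ← pow_mul, Nat.mul_div_cancel' hc]
  simp_rw [mul_comm _ p, pow_mul]
  rw [← geom_sum_mulVec_eq_iff (B ^ p) hco, hfac m (hp ▸ Nat.gcd_dvd_left m n),
    hfac n (hp ▸ Nat.gcd_dvd_right m n), ← Matrix.mulVec_mulVec, ← Matrix.mulVec_mulVec]
  exact hinj.eq_iff
end
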